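/- Let M be a finite monoid and m ∈ ℕ. Then: M ∈ R_m iff there exist a finite alphabet Σ and n ∈ ℕ_0 such that M divides Σ*/≡_{m,n}^X; M ∈ L_m iff there exist a finite alphabet Σ and n ∈ ℕ_0 such that M divides Σ*/≡_{m,n}^Y; M ∈ R_m ∨ L_m iff there exist a finite alphabet Σ and n ∈ ℕ_0 such that M divides Σ*/≡_{m,n}^{XY}; and M ∈ R_{m+1} ∩ L_{m+1} iff there exist a finite alphabet Σ and n ∈ ℕ_0 such that M divides Σ*/≡_{m,n}^{WI}. -/

import Mathlib

open scoped Classical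

/-! ## Generalized words -/

structure GWord (A : Type) : Type 1 where
  P : Type
  ord : LinearOrder P
  w : P → A

namespace GWord

variable {A : Type}

instance (u : GWord A) : LinearOrder u.P := u.ord

/-- The set of letters occurring in a generalized word. -/
def alph (u : GWord A) : Set A := Set.range u.w

/-- Restriction of a generalized word to a set of positions. -/
def restrict (u : GWord A) (s : Set u.P) : GWord A :=
  ⟨{ p // p ∈ s }, inferInstance, fun p => u.w p.1⟩

/-- `p` is the first `a`-labelled position of `u`. -/
def IsFirst (u : GWord A) (a : A) (p : u.P) : Prop :=
  u.w p = a ∧ ∀ q : u.P, u.w q = a → p ≤ q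

/-- `p` is the last `a`-labelled position of `u`. -/
def IsLast (u : GWord A) (a : A) (p : u.P) : Prop :=
  u.w p = a ∧ ∀ q : u.P, u.w q = a → q ≤ p

/-- The factor strictly before the first occurrence of `a`. -/
noncomputable def XL (u : GWord A) (a : A) : GWord A :=
  if h : ∃ p, u.IsFirst a p then u.restrict {q | q < h.choose} else u

/-- The factor strictly after the first occurrence of `a`. -/
noncomputable def XR (u : GWord A) (a : A) : GWord A :=
  if h : ∃ p, u.IsFirst a p then u.restrict {q | h.choose < q} else u

/-- The factor strictly before the last occurrence of `a`. -/
noncomputable def YL (u : GWord A) (a : A) : GWord A :=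
  if h : ∃ p, u.IsLast a p then u.restrict {q | q < h.choose} else u

/-- The factor strictly after the last occurrence of `a`. -/
noncomputable def YR (u : GWord A) (a : A) : GWord A :=
  if h : ∃ p, u.IsLast a p then u.restrict {q | h.choose < q} else u

/-- `C_{a,b}` is defined iff the first `a` is strictly to the right of the last `b`. -/
def CDefined (u : GWord A) (a b : A) : Prop :=
  ∃ p q, u.IsFirst a p ∧ u.IsLast b q ∧ q < p

/-- The factor strictly between the last `b` and the first `a` (junk value if undefined). -/
noncomputable def Cab (u : GWord A) (a b : A) : GWord A :=
  if h : u.CDefined a b then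
    u.restrict {r | h.choose_spec.choose < r ∧ r < h.choose}
  else u

/-- Accessibility: first/last occurrences of letters after/before every position exist. -/
def Accessible (u : GWord A) : Prop :=
  (∀ a : A, (∃ p, u.w p = a) → ∃ p, u.IsFirst a p) ∧
  (∀ a : A, (∃ p, u.w p = a) → ∃ p, u.IsLast a p) ∧
  (∀ (p : u.P) (a : A), (∃ q, p < q ∧ u.w q = a) →
    ∃ q, p < q ∧ u.w q = a ∧ ∀ r, p < r → u.w r = a → q ≤ r) ∧
  (∀ (p : u.P) (a : A), (∃ q, q < p ∧ u.w q = a) →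
    ∃ q, q < p ∧ u.w q = a ∧ ∀ r, r < p → u.w r = a → r ≤ q)

/-- Concatenation of generalized words. -/
def append (u v : GWord A) : GWord A :=
  ⟨u.P ⊕ₗ v.P, inferInstance, fun x => Sum.elim u.w v.w (ofLex x)⟩

/-- The power of a generalized word by an arbitrary linear order type `ν`
(positions ordered with the exponent component dominant). -/
def gpow (u : GWord A) (ν : Type) [LinearOrder ν] : GWord A :=
  ⟨ν ×ₗ u.P, inferInstance, fun x => u.w (ofLex x).2⟩

/-- A finite word as a generalized word. -/
def ofList (l : List A) : GWord A :=
  ⟨Fin l.length, inferInstance, fun i => l.get i⟩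

end GWord

/-- The order type `ω + ω*`: a copy of `ℕ` followed by a reversed copy of `ℕ`. -/
abbrev OO : Type := ℕ ⊕ₗ ℕᵒᵈ

/-! ## The relations `≡_{m,n}^Z` -/

inductive ZK : Type
  | X | Y | WI

inductive ZKind : Type
  | X | Y | XY | WI

/-- The relations `≡_{m,n}^X`, `≡_{m,n}^Y`, `≡_{m,n}^{WI}` (first argument is `n`). -/
def eqvAux {A : Type} : ℕ → ZK → ℕ → GWord A → GWord A → Prop
  | 0, _, _, _, _ => True
  | _ + 1, _, 0, _, _ => True
  | n + 1, ZK.X, m + 1, u, v =>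
      u.alph = v.alph ∧ eqvAux n ZK.Y m u v ∧
      ∀ a ∈ u.alph, eqvAux n ZK.Y m (u.XL a) (v.XL a) ∧
        eqvAux n ZK.X (m + 1) (u.XR a) (v.XR a)
  | n + 1, ZK.Y, m + 1, u, v =>
      u.alph = v.alph ∧ eqvAux n ZK.X m u v ∧
      ∀ a ∈ u.alph, eqvAux n ZK.Y (m + 1) (u.YL a) (v.YL a) ∧
        eqvAux n ZK.X m (u.YR a) (v.YR a)
  | n + 1, ZK.WI, m + 1, u, v =>
      u.alph = v.alph ∧
      (∀ a ∈ u.alph,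
        eqvAux n ZK.WI m (u.XL a) (v.XL a) ∧ eqvAux n ZK.WI (m + 1) (u.XR a) (v.XR a) ∧
        eqvAux n ZK.WI (m + 1) (u.YL a) (v.YL a) ∧ eqvAux n ZK.WI m (u.YR a) (v.YR a)) ∧
      ∀ a ∈ u.alph, ∀ b ∈ u.alph,
        (u.CDefined a b ↔ v.CDefined a b) ∧
        (u.CDefined a b → v.CDefined a b → eqvAux n ZK.WI m (u.Cab a b) (v.Cab a b))

/-- `wEquiv Z m n u v` is `u ≡_{m,n}^Z v`. -/
def wEquiv {A : Type} (Z : ZKind) (m n : ℕ) (u v : GWord A) : Prop :=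
  match Z with
  | ZKind.X => eqvAux n ZK.X m u v
  | ZKind.Y => eqvAux n ZK.Y m u v
  | ZKind.XY => eqvAux n ZK.X m u v ∧ eqvAux n ZK.Y m u v
  | ZKind.WI => eqvAux n ZK.WI m u v

/-! ## π-terms -/

inductive PiTerm (A : Type) : Type
  | eps : PiTerm A
  | letter : A → PiTerm A
  | mul : PiTerm A → PiTerm A → PiTerm A
  | pi : PiTerm A → PiTerm A

def listNPow {A : Type} (l : List A) : ℕ → List A
  | 0 => []
  | k + 1 => l ++ listNPow l k

/-- `[γ]_k`: substitute the natural number `k` for the formal power `π`. -/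
def PiTerm.substNat {A : Type} : PiTerm A → ℕ → List A
  | .eps, _ => []
  | .letter a, _ => [a]
  | .mul α β, k => α.substNat k ++ β.substNat k
  | .pi γ, k => listNPow (γ.substNat k) k

/-- `[γ]_{ω+ω*}`: substitute the order type `ω + ω*` for the formal power `π`. -/
def PiTerm.substOO {A : Type} : PiTerm A → GWord A
  | .eps => GWord.ofList []
  | .letter a => GWord.ofList [a]
  | .mul α β => α.substOO.append β.substOO
  | .pi γ => γ.substOO.gpow OO

/-! ## Finite monoids, equations, the Trotter–Weil hierarchy -/

/-- `M!`: the exponent of a finite monoid, the least `n ≥ 1` such that all `x^n` are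
idempotent. -/
noncomputable def monoidExp (M : Type) [Monoid M] : ℕ :=
  sInf {n : ℕ | 1 ≤ n ∧ ∀ x : M, IsIdempotentElem (x ^ n)}

/-- The equation `α = β` of π-terms holds in the finite monoid `M`. -/
def EqHoldsIn {A : Type} (α β : PiTerm A) (M : Type) [Monoid M] : Prop :=
  ∀ σ : FreeMonoid A →* M,
    σ (FreeMonoid.ofList (α.substNat (monoidExp M))) =
      σ (FreeMonoid.ofList (β.substNat (monoidExp M)))

/-- Green's relation `R`: `x R y` iff `xM = yM`. -/
def rGreen {M : Type} [Monoid M] (x y : M) : Prop :=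
  Set.range (fun z => x * z) = Set.range (fun z => y * z)

/-- Green's relation `L`: `x L y` iff `Mx = My`. -/
def lGreen {M : Type} [Monoid M] (x y : M) : Prop :=
  Set.range (fun z => z * x) = Set.range (fun z => z * y)

/-- `J`-triviality: `MxM = MyM` implies `x = y`. -/
def IsJTrivial (M : Type) [Monoid M] : Prop :=
  ∀ x y : M, {z | ∃ a b, z = a * x * b} = {z | ∃ a b, z = a * y * b} → x = y

/-- The relation `∼_K`. -/
def simK {M : Type} [Monoid M] (x y : M) : Prop :=
  ∀ e : M, IsIdempotentElem e → (rGreen (e * x) e ∨ rGreen (e * y) e) → e * x = e * y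

/-- The relation `∼_D`. -/
def simD {M : Type} [Monoid M] (x y : M) : Prop :=
  ∀ e : M, IsIdempotentElem e → (lGreen (x * e) e ∨ lGreen (y * e) e) → x * e = y * e

/-- `∼_K` as a congruence (it is a congruence, so `conGen` does not change it). -/
def KCon (M : Type) [Monoid M] : Con M := conGen simK

/-- `∼_D` as a congruence. -/
def DCon (M : Type) [Monoid M] : Con M := conGen simD

/-- `InRLAux k true M _ = (M ∈ R_{k+1})` and `InRLAux k false M _ = (M ∈ L_{k+1})`. -/
def InRLAux : ℕ → Bool → (M : Type) → Monoid M → Prop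
  | 0, _, M, i => letI := i; IsJTrivial M
  | k + 1, true, M, i => letI := i; InRLAux k false (KCon M).Quotient inferInstance
  | k + 1, false, M, i => letI := i; InRLAux k true (DCon M).Quotient inferInstance

/-- `M ∈ R_m` (for `m ≥ 1`). -/
def InRm (m : ℕ) (M : Type) [i : Monoid M] : Prop := InRLAux (m - 1) true M i

/-- `M ∈ L_m` (for `m ≥ 1`). -/
def InLm (m : ℕ) (M : Type) [i : Monoid M] : Prop := InRLAux (m - 1) false M i

/-- `N` divides `M`: `N` is a homomorphic image of a submonoid of `M`. -/
def MDivides (N M : Type) [Monoid N] [Monoid M] : Prop :=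
  ∃ (S : Submonoid M) (f : S →* N), Function.Surjective f

/-- `N ∈ R_m ∨ L_m`: `N` divides a direct product `M₁ × M₂` with `M₁ ∈ R_m`, `M₂ ∈ L_m`. -/
def InJoin (m : ℕ) (N : Type) [Monoid N] : Prop :=
  ∃ (M₁ M₂ : Type) (i₁ : Monoid M₁) (i₂ : Monoid M₂),
    letI := i₁; letI := i₂;
    Finite M₁ ∧ Finite M₂ ∧ InRm m M₁ ∧ InLm m M₂ ∧ MDivides N (M₁ × M₂)

/-- `M ∈ DA`, via the equation `(xyz)^{M!} y (xyz)^{M!} = (xyz)^{M!}`. -/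
def InDA (M : Type) [Monoid M] : Prop :=
  ∀ x y z : M,
    (x * y * z) ^ monoidExp M * y * (x * y * z) ^ monoidExp M = (x * y * z) ^ monoidExp M

/-! ## The π-terms `U_m`, `V_m` -/

inductive UVLetter : Type
  | s | t | x (i : ℕ) | y (i : ℕ)

/-- `U_m` (indexed from 1; `Uterm 0` is a junk value). -/
def Uterm : ℕ → PiTerm UVLetter
  | 0 => PiTerm.eps
  | 1 =>
      PiTerm.mul
        (PiTerm.pi (PiTerm.mul (PiTerm.letter UVLetter.s) (PiTerm.letter (UVLetter.x 1))))
        (PiTerm.mul (PiTerm.letter UVLetter.s)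
          (PiTerm.pi (PiTerm.mul (PiTerm.letter (UVLetter.y 1)) (PiTerm.letter UVLetter.t))))
  | m + 2 =>
      PiTerm.mul
        (PiTerm.pi (PiTerm.mul (Uterm (m + 1)) (PiTerm.letter (UVLetter.x (m + 2)))))
        (PiTerm.mul (Uterm (m + 1))
          (PiTerm.pi (PiTerm.mul (PiTerm.letter (UVLetter.y (m + 2))) (Uterm (m + 1)))))

/-- `V_m` (indexed from 1; `Vterm 0` is a junk value). -/
def Vterm : ℕ → PiTerm UVLetter
  | 0 => PiTerm.eps
  | 1 =>
      PiTerm.mul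
        (PiTerm.pi (PiTerm.mul (PiTerm.letter UVLetter.s) (PiTerm.letter (UVLetter.x 1))))
        (PiTerm.mul (PiTerm.letter UVLetter.t)
          (PiTerm.pi (PiTerm.mul (PiTerm.letter (UVLetter.y 1)) (PiTerm.letter UVLetter.t))))
  | m + 2 =>
      PiTerm.mul
        (PiTerm.pi (PiTerm.mul (Uterm (m + 1)) (PiTerm.letter (UVLetter.x (m + 2)))))
        (PiTerm.mul (Vterm (m + 1))
          (PiTerm.pi (PiTerm.mul (PiTerm.letter (UVLetter.y (m + 2))) (Uterm (m + 1)))))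

/-- The relation `≡_{m,n}^Z` on the free monoid `Σ*`, as a congruence
(it is a congruence, so `conGen` does not change it). -/
def eqvCon (A : Type) (Z : ZKind) (m n : ℕ) : Con (FreeMonoid A) :=
  conGen (fun u v => wEquiv Z m n (GWord.ofList u.toList) (GWord.ofList v.toList))

/-! ## The relations on lists -/

section ListRelations

variable {A : Type}

theorem first_split_unique {a : A} : ∀ {s s' r r' : List A}, s ++ a :: r = s' ++ a :: r' →
    a ∉ s → a ∉ s' → s = s' ∧ r = r'
  | [], [], _, _, h, _, _ => by simpa using h
  | [], c :: s', _, _, h, _, h' => by simp at h; simp [h.1] at h'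
  | c :: s, [], _, _, h, h', _ => by simp at h; simp [h.1] at h'
  | c :: s, d :: s', r, r', h, h1, h2 => by
      simp only [List.cons_append, List.cons.injEq] at h
      obtain ⟨h3, h4⟩ := first_split_unique h.2 (fun hh => h1 (by simp [hh]))
        (fun hh => h2 (by simp [hh]))
      exact ⟨by rw [h.1, h3], h4⟩

theorem last_split_unique {a : A} {s s' r r' : List A} (h : s ++ a :: r = s' ++ a :: r')
    (h1 : a ∉ r) (h2 : a ∉ r') : s = s' ∧ r = r' := by
  have h3 : r.reverse ++ a :: s.reverse = r'.reverse ++ a :: s'.reverse := by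
    have := congrArg List.reverse h
    simpa using this
  obtain ⟨h4, h5⟩ := first_split_unique h3 (by simpa using h1) (by simpa using h2)
  exact ⟨List.reverse_injective h5, List.reverse_injective h4⟩

theorem exists_first_split {a : A} {u : List A} (h : a ∈ u) :
    ∃ s r, u = s ++ a :: r ∧ a ∉ s := List.eq_append_cons_of_mem h

theorem exists_last_split {a : A} {u : List A} (h : a ∈ u) :
    ∃ s r, u = s ++ a :: r ∧ a ∉ r := by
  obtain ⟨s, r, h1, h2⟩ := exists_first_split (List.mem_reverse.2 h)
  refine ⟨r.reverse, s.reverse, ?_, by simpa using h2⟩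
  have := congrArg List.reverse h1
  simpa using this

/-- The relation `≡_{m,n}^X` on lists (first argument is `n`); `≡_{m,n}^Y` is the relation
`≡_{m,n}^X` between the reversed lists. -/
def ListX : ℕ → ℕ → List A → List A → Prop
  | 0, _, _, _ => True
  | _ + 1, 0, _, _ => True
  | n + 1, m + 1, u, v =>
      (∀ a, a ∈ u ↔ a ∈ v) ∧ ListX n m u.reverse v.reverse ∧
      ∀ a s r p q, u = s ++ a :: r → a ∉ s → v = p ++ a :: q → a ∉ p →
        ListX n m s.reverse p.reverse ∧ ListX n (m + 1) r q

/-- The first `a` of the list is strictly to the right of its last `b`. -/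
def CSplit (u : List A) (a b : A) : Prop :=
  ∃ s t r, u = s ++ b :: (t ++ a :: r) ∧ a ∉ s ++ b :: t ∧ b ∉ t ++ a :: r

/-- The relation `≡_{m,n}^{WI}` on lists (first argument is `n`). -/
def ListW : ℕ → ℕ → List A → List A → Prop
  | 0, _, _, _ => True
  | _ + 1, 0, _, _ => True
  | n + 1, m + 1, u, v =>
      (∀ a, a ∈ u ↔ a ∈ v) ∧
      (∀ a s r s' r', u = s ++ a :: r → a ∉ s → v = s' ++ a :: r' → a ∉ s' →
        ListW n m s s' ∧ ListW n (m + 1) r r') ∧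
      (∀ a s r s' r', u = s ++ a :: r → a ∉ r → v = s' ++ a :: r' → a ∉ r' →
        ListW n (m + 1) s s' ∧ ListW n m r r') ∧
      (∀ a b, CSplit u a b ↔ CSplit v a b) ∧
      ∀ a b s t r s' t' r', u = s ++ b :: (t ++ a :: r) → a ∉ s ++ b :: t → b ∉ t ++ a :: r →
        v = s' ++ b :: (t' ++ a :: r') → a ∉ s' ++ b :: t' → b ∉ t' ++ a :: r' → ListW n m t t'

theorem ListX.zero_left (m : ℕ) (u v : List A) : ListX 0 m u v := by
  cases m <;> trivial

theorem ListX.zero_right (n : ℕ) (u v : List A) : ListX n 0 u v := by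
  cases n <;> trivial

theorem ListW.zero_left (m : ℕ) (u v : List A) : ListW 0 m u v := by
  cases m <;> trivial

theorem ListW.zero_right (n : ℕ) (u v : List A) : ListW n 0 u v := by
  cases n <;> trivial

theorem ListX.refl (n m : ℕ) (u : List A) : ListX n m u u := by
  induction n generalizing m u with
  | zero => exact zero_left _ _ _
  | succ n ih =>
    cases m with
    | zero => exact zero_right _ _ _
    | succ m =>
      refine ⟨fun _ => Iff.rfl, ih _ _, ?_⟩
      rintro a s r s' r' rfl h1 h2 h3
      obtain ⟨rfl, rfl⟩ := first_split_unique h2 h1 h3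
      exact ⟨ih _ _, ih _ _⟩

theorem ListW.refl (n m : ℕ) (u : List A) : ListW n m u u := by
  induction n generalizing m u with
  | zero => exact zero_left _ _ _
  | succ n ih =>
    cases m with
    | zero => exact zero_right _ _ _
    | succ m =>
      refine ⟨fun _ => Iff.rfl, ?_, ?_, fun _ _ => Iff.rfl, ?_⟩
      · rintro a s r s' r' rfl h1 h2 h3
        obtain ⟨rfl, rfl⟩ := first_split_unique h2 h1 h3
        exact ⟨ih _ _, ih _ _⟩
      · rintro a s r s' r' rfl h1 h2 h3
        obtain ⟨rfl, rfl⟩ := last_split_unique h2 h1 h3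
        exact ⟨ih _ _, ih _ _⟩
      · rintro a b s t r s' t' r' rfl h1 h2 h3 h4 h5
        obtain ⟨rfl, h6⟩ := last_split_unique h3 h2 h5
        have h7 : a ∉ t := fun h => h1 (by simp [h])
        have h8 : a ∉ t' := fun h => h4 (by simp [h])
        obtain ⟨rfl, -⟩ := first_split_unique h6 h7 h8
        exact ih _ _

theorem ListX.symm {n m : ℕ} {u v : List A} (h : ListX n m u v) : ListX n m v u := by
  induction n generalizing m u v with
  | zero => exact zero_left _ _ _
  | succ n ih =>
    cases m with
    | zero => exact zero_right _ _ _
    | succ m =>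
      obtain ⟨h1, h2, h3⟩ := h
      refine ⟨fun a => (h1 a).symm, ih h2, ?_⟩
      intro a s r s' r' h4 h5 h6 h7
      obtain ⟨h8, h9⟩ := h3 a s' r' s r h6 h7 h4 h5
      exact ⟨ih h8, ih h9⟩

theorem ListX.trans {n m : ℕ} {u v w : List A} (h : ListX n m u v) (h' : ListX n m v w) :
    ListX n m u w := by
  induction n generalizing m u v w with
  | zero => exact zero_left _ _ _
  | succ n ih =>
    cases m with
    | zero => exact zero_right _ _ _
    | succ m =>
      obtain ⟨h1, h2, h3⟩ := h
      obtain ⟨h1', h2', h3'⟩ := h'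
      refine ⟨fun a => (h1 a).trans (h1' a), ih h2 h2', ?_⟩
      intro a s r s' r' h4 h5 h6 h7
      obtain ⟨t, q, h8, h9⟩ := exists_first_split ((h1 a).1 (by simp [h4]))
      obtain ⟨h10, h11⟩ := h3 a s r t q h4 h5 h8 h9
      obtain ⟨h12, h13⟩ := h3' a t q s' r' h8 h9 h6 h7
      exact ⟨ih h10 h12, ih h11 h13⟩

theorem ListX.mono {n n' m m' : ℕ} {u v : List A} (h : ListX n m u v) (hn : n' ≤ n)
    (hm : m' ≤ m) : ListX n' m' u v := by
  induction n' generalizing n m m' u v with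
  | zero => exact zero_left _ _ _
  | succ n' ih =>
    obtain ⟨n, rfl⟩ : ∃ k, n = k + 1 := ⟨n - 1, by omega⟩
    cases m' with
    | zero => exact zero_right _ _ _
    | succ m' =>
      obtain ⟨m, rfl⟩ : ∃ k, m = k + 1 := ⟨m - 1, by omega⟩
      obtain ⟨h1, h2, h3⟩ := h
      refine ⟨h1, ih h2 (by omega) (by omega), ?_⟩
      intro a s r s' r' h4 h5 h6 h7
      obtain ⟨h8, h9⟩ := h3 a s r s' r' h4 h5 h6 h7
      exact ⟨ih h8 (by omega) (by omega), ih h9 (by omega) (by omega)⟩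

theorem ListW.mono {n n' m m' : ℕ} {u v : List A} (h : ListW n m u v) (hn : n' ≤ n)
    (hm : m' ≤ m) : ListW n' m' u v := by
  induction n' generalizing n m m' u v with
  | zero => exact zero_left _ _ _
  | succ n' ih =>
    obtain ⟨n, rfl⟩ : ∃ k, n = k + 1 := ⟨n - 1, by omega⟩
    cases m' with
    | zero => exact zero_right _ _ _
    | succ m' =>
      obtain ⟨m, rfl⟩ : ∃ k, m = k + 1 := ⟨m - 1, by omega⟩
      obtain ⟨h1, h2, h3, h4, h5⟩ := h
      refine ⟨h1, ?_, ?_, h4, ?_⟩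
      · intro a s r s' r' g1 g2 g3 g4
        obtain ⟨h8, h9⟩ := h2 a s r s' r' g1 g2 g3 g4
        exact ⟨ih h8 (by omega) (by omega), ih h9 (by omega) (by omega)⟩
      · intro a s r s' r' g1 g2 g3 g4
        obtain ⟨h8, h9⟩ := h3 a s r s' r' g1 g2 g3 g4
        exact ⟨ih h8 (by omega) (by omega), ih h9 (by omega) (by omega)⟩
      · intro a b s t r s' t' r' g1 g2 g3 g4 g5 g6
        exact ih (h5 a b s t r s' t' r' g1 g2 g3 g4 g5 g6) (by omega) (by omega)

theorem ListX.append {n m : ℕ} {u v u' v' : List A} (h : ListX n m u v) (h' : ListX n m u' v') :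
    ListX n m (u ++ u') (v ++ v') := by
  induction n generalizing m u v u' v' with
  | zero => exact zero_left _ _ _
  | succ n ih =>
    cases m with
    | zero => exact zero_right _ _ _
    | succ m =>
      obtain ⟨h1, h2, h3⟩ := h
      have hh' := h'
      obtain ⟨h1', h2', h3'⟩ := h'
      refine ⟨fun a => by simp [h1 a, h1' a], by simpa using ih h2' h2, ?_⟩
      intro a s r s' r' h4 h5 h6 h7
      by_cases ha : a ∈ u
      · obtain ⟨t, q, rfl, h9⟩ := exists_first_split ha
        obtain ⟨t', q', rfl, h9'⟩ := exists_first_split ((h1 a).1 ha)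
        have h4 : t ++ a :: (q ++ u') = s ++ a :: r := by simpa using h4
        have h6 : t' ++ a :: (q' ++ v') = s' ++ a :: r' := by simpa using h6
        obtain ⟨rfl, rfl⟩ := first_split_unique h4 h9 h5
        obtain ⟨rfl, rfl⟩ := first_split_unique h6 h9' h7
        obtain ⟨h10, h11⟩ := h3 a _ _ _ _ rfl h9 rfl h9'
        exact ⟨h10, ih h11 (hh'.mono (by omega) le_rfl)⟩
      · have hav : a ∉ v := fun h => ha ((h1 a).2 h)
        have ha' : a ∈ u' := by
          have : a ∈ u ++ u' := by simp [h4]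
          simpa [ha] using this
        obtain ⟨t, q, rfl, h9⟩ := exists_first_split ha'
        obtain ⟨t', q', rfl, h9'⟩ := exists_first_split ((h1' a).1 ha')
        have h4 : (u ++ t) ++ a :: q = s ++ a :: r := by simpa using h4
        have h6 : (v ++ t') ++ a :: q' = s' ++ a :: r' := by simpa using h6
        obtain ⟨rfl, rfl⟩ := first_split_unique h4 (by simp [ha, h9]) h5
        obtain ⟨rfl, rfl⟩ := first_split_unique h6 (by simp [hav, h9']) h7
        obtain ⟨h10, h11⟩ := h3' a _ _ _ _ rfl h9 rfl h9'
        exact ⟨by simpa using ih h10 h2, h11⟩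

theorem CSplit.reverse {u : List A} {a b : A} (h : CSplit u a b) : CSplit u.reverse b a := by
  obtain ⟨s, t, r, rfl, h1, h2⟩ := h
  refine ⟨r.reverse, t.reverse, s.reverse, by simp, ?_, ?_⟩
  · grind
  · grind

theorem cSplit_reverse {u : List A} {a b : A} : CSplit u.reverse b a ↔ CSplit u a b :=
  ⟨fun h => by simpa using h.reverse, fun h => h.reverse⟩

theorem ListW.reverse {n m : ℕ} {u v : List A} (h : ListW n m u v) :
    ListW n m u.reverse v.reverse := by
  induction n generalizing m u v with
  | zero => exact zero_left _ _ _
  | succ n ih =>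
    cases m with
    | zero => exact zero_right _ _ _
    | succ m =>
      obtain ⟨h1, h2, h3, h4, h5⟩ := h
      have key : ∀ {w s r : List A} {a : A}, w.reverse = s ++ a :: r →
          w = r.reverse ++ a :: s.reverse := by
        intro w s r a h
        have := congrArg List.reverse h
        simpa using this
      have mem : ∀ {s t : List A} {a b : A}, a ∉ s ++ b :: t →
          a ∉ t.reverse ++ b :: s.reverse := by
        intro s t a b h
        simp only [List.mem_append, List.mem_cons, List.mem_reverse] at h ⊢
        tauto
      refine ⟨fun a => by simp [h1 a], ?_, ?_, fun a b => ?_, ?_⟩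
      · intro a s r s' r' g1 g2 g3 g4
        obtain ⟨h8, h9⟩ := h3 a _ _ _ _ (key g1) (by simpa using g2) (key g3) (by simpa using g4)
        exact ⟨by simpa using ih h9, by simpa using ih h8⟩
      · intro a s r s' r' g1 g2 g3 g4
        obtain ⟨h8, h9⟩ := h2 a _ _ _ _ (key g1) (by simpa using g2) (key g3) (by simpa using g4)
        exact ⟨by simpa using ih h9, by simpa using ih h8⟩
      · rw [cSplit_reverse, cSplit_reverse]; exact h4 b a
      · intro a b s t r s' t' r' g1 g2 g3 g4 g5 g6
        have k1 := key g1
        have k2 := key g4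
        simp only [List.reverse_append, List.reverse_cons, List.append_assoc,
          List.singleton_append] at k1 k2
        have := h5 b a r.reverse t.reverse s.reverse r'.reverse t'.reverse s'.reverse
          (by simpa using k1)
          (mem g3) (mem g2)
          (by simpa using k2) (mem g6) (mem g5)
        simpa using ih this

end ListRelations

section Comparison

variable {A : Type}

theorem reverse_split {w s r : List A} {a : A} (h : w = s ++ a :: r) :
    w.reverse = r.reverse ++ a :: s.reverse := by
  simp [h]

theorem ListX.last_left {n m : ℕ} {u v s r s' r' : List A} {a : A}
    (h : ListX (n + 2) (m + 2) u v) (hu : u = s ++ a :: r) (hr : a ∉ r)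
    (hv : v = s' ++ a :: r') (hr' : a ∉ r') : ListX n (m + 2) s s' := by
  induction n generalizing u v s s' with
  | zero => exact zero_left _ _ _
  | succ n ih =>
    obtain ⟨h1, h2, h3⟩ := h
    have h4 := (h2.2.2 a _ _ _ _ (reverse_split hu) (by simpa using hr) (reverse_split hv)
      (by simpa using hr')).2
    have hs : ∀ c, c ∈ s ↔ c ∈ s' := fun c => by simpa using h4.1 c
    refine ⟨hs, h4.mono (by omega) le_rfl, ?_⟩
    rintro b s1 s2 t1 t2 rfl hb rfl hb'
    obtain ⟨h5, h6⟩ := h3 b s1 (s2 ++ a :: r) t1 (t2 ++ a :: r') (by simp [hu]) hb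
      (by simp [hv]) hb'
    exact ⟨h5.mono (by omega) le_rfl, ih h6 rfl rfl⟩

theorem ListX.first_left {n m : ℕ} {u v s r s' r' : List A} {a : A}
    (h : ListX (n + 1) (m + 2) u v) (hu : u = s ++ a :: r) (hs : a ∉ s)
    (hv : v = s' ++ a :: r') (hs' : a ∉ s') : ListX n (m + 2) s s' := by
  induction n generalizing u v s s' with
  | zero => exact zero_left _ _ _
  | succ n ih =>
    obtain ⟨h1, h2, h3⟩ := h
    have h4 := (h3 a _ _ _ _ hu hs hv hs').1
    refine ⟨fun c => by simpa using h4.1 c, h4.mono (by omega) le_rfl, ?_⟩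
    rintro b s1 s2 t1 t2 rfl hb rfl hb'
    obtain ⟨h5, h6⟩ := h3 b s1 (s2 ++ a :: r) t1 (t2 ++ a :: r') (by simp [hu]) hb
      (by simp [hv]) hb'
    exact ⟨h5.mono (by omega) le_rfl, ih h6 rfl (fun h => hs (by simp [h])) rfl
      (fun h => hs' (by simp [h]))⟩

theorem ListX.last_right {n m : ℕ} {u v s r s' r' : List A} {a : A}
    (h : ListX (n + 1) (m + 2) u.reverse v.reverse) (hu : u = s ++ a :: r) (hr : a ∉ r)
    (hv : v = s' ++ a :: r') (hr' : a ∉ r') : ListX n (m + 2) r.reverse r'.reverse :=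
  h.first_left (reverse_split hu) (by simpa using hr) (reverse_split hv) (by simpa using hr')

theorem CSplit.ne {u : List A} {a b : A} (h : CSplit u a b) : a ≠ b := by
  rintro rfl
  obtain ⟨s, t, r, -, h1, -⟩ := h
  exact h1 (by simp)

theorem cSplit_iff {u : List A} {a b : A} :
    CSplit u a b ↔ a ≠ b ∧ b ∈ u ∧ ∃ s r, u = s ++ a :: r ∧ a ∉ s ∧ b ∉ r := by
  constructor
  · intro h
    refine ⟨h.ne, ?_⟩
    obtain ⟨s, t, r, rfl, h1, h2⟩ := h
    exact ⟨by simp, s ++ b :: t, r, by simp, h1, fun h => h2 (by simp [h])⟩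
  · rintro ⟨hab, hb, s, r, rfl, h1, h2⟩
    have hb : b ∈ s := by simpa [h2, hab.symm] using hb
    obtain ⟨s1, t, rfl, h3⟩ := exists_last_split hb
    exact ⟨s1, t, r, by simp, h1, by simp [h2, h3, hab.symm]⟩

theorem ListX.listW {n m : ℕ} {u v : List A} (h : ListX (2 * n) (m + 1) u v) :
    ListW n m u v := by
  induction n generalizing m u v with
  | zero => exact ListW.zero_left _ _ _
  | succ n ih =>
    cases m with
    | zero => exact ListW.zero_right _ _ _
    | succ m =>
      obtain ⟨h1, h2, h3⟩ : ListX (2 * n + 2) (m + 2) u v := h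
      have ih' : ∀ {m : ℕ} {u v : List A}, ListX (2 * n) (m + 1) u.reverse v.reverse →
          ListW n m u v := fun h => by simpa using (ih h).reverse
      refine ⟨h1, ?_, ?_, fun a b => ?_, ?_⟩
      · intro a s r s' r' g1 g2 g3 g4
        obtain ⟨h4, h5⟩ := h3 a s r s' r' g1 g2 g3 g4
        exact ⟨ih' (h4.mono (by omega) le_rfl), ih (h5.mono (by omega) le_rfl)⟩
      · intro a s r s' r' g1 g2 g3 g4
        refine ⟨ih (ListX.last_left (n := 2 * n) ⟨h1, h2, h3⟩ g1 g2 g3 g4), ?_⟩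
        cases m with
        | zero => exact ListW.zero_right _ _ _
        | succ m => exact ih' (ListX.last_right (n := 2 * n) h2 g1 g2 g3 g4)
      · have key : ∀ {u v : List A}, ListX (2 * n + 2) (m + 2) u v → CSplit u a b →
            CSplit v a b := by
          intro u v h hc
          obtain ⟨h1, h2, h3⟩ := h
          obtain ⟨hab, hb, s, r, hu, hs, hr⟩ := cSplit_iff.1 hc
          obtain ⟨s', r', hv, hs'⟩ := exists_first_split ((h1 a).1 (by simp [hu]))
          have h4 := (h3 a s r s' r' hu hs hv hs').2
          exact cSplit_iff.2 ⟨hab, (h1 b).1 hb, s', r', hv, hs', fun h => hr ((h4.1 b).2 h)⟩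
        exact ⟨key ⟨h1, h2, h3⟩, key (ListX.symm ⟨h1, h2, h3⟩)⟩
      · intro a b s t r s' t' r' g1 g2 g3 g4 g5 g6
        cases m with
        | zero => exact ListW.zero_right _ _ _
        | succ m =>
          have h4 := (h3 a (s ++ b :: t) r (s' ++ b :: t') r' (by simp [g1]) g2
            (by simp [g4]) g5).1
          exact ih' (ListX.last_right (n := 2 * n) h4 rfl (fun h => g3 (by simp [h])) rfl
            (fun h => g6 (by simp [h])))

/-! ### Subwords -/

/-- The two lists have the same (scattered) subwords of length at most `n`. -/
def SubwordEquiv (n : ℕ) (u v : List A) : Prop :=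
  ∀ w : List A, w.length ≤ n → (w.Sublist u ↔ w.Sublist v)

theorem cons_sublist_first_split {a : A} {s r w : List A} (hs : a ∉ s) :
    (a :: w).Sublist (s ++ a :: r) ↔ w.Sublist r := by
  induction s with
  | nil => simp
  | cons c s ih =>
    simp only [List.mem_cons, not_or] at hs
    rw [List.cons_append, ← ih hs.2]
    constructor
    · intro h
      cases h with
      | cons _ h => exact h
      | cons_cons _ h => exact absurd rfl hs.1
    · intro h
      exact h.cons _

theorem SubwordEquiv.mono {n n' : ℕ} {u v : List A} (h : SubwordEquiv n u v) (hn : n' ≤ n) :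
    SubwordEquiv n' u v := fun w hw => h w (hw.trans hn)

theorem SubwordEquiv.mem_iff {n : ℕ} {u v : List A} (h : SubwordEquiv (n + 1) u v) (a : A) :
    a ∈ u ↔ a ∈ v := by
  simpa using h [a] (by simp)

theorem SubwordEquiv.first_right {n : ℕ} {u v s r s' r' : List A} {a : A}
    (h : SubwordEquiv (n + 1) u v) (hu : u = s ++ a :: r) (hs : a ∉ s)
    (hv : v = s' ++ a :: r') (hs' : a ∉ s') : SubwordEquiv n r r' := by
  subst hu hv
  intro w hw
  rw [← cons_sublist_first_split (r := r) hs, ← cons_sublist_first_split (r := r') hs']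
  exact h (a :: w) (by simpa using hw)

theorem SubwordEquiv.reverse {n : ℕ} {u v : List A} (h : SubwordEquiv n u v) :
    SubwordEquiv n u.reverse v.reverse := by
  intro w hw
  rw [← List.reverse_sublist, ← List.reverse_sublist (l₂ := v.reverse)]
  simpa using h w.reverse (by simpa using hw)

theorem listX_one_iff {n : ℕ} {u v : List A} : ListX n 1 u v ↔ SubwordEquiv n u v := by
  induction n generalizing u v with
  | zero =>
    refine ⟨fun _ w hw => ?_, fun _ => ListX.zero_left _ _ _⟩
    obtain rfl : w = [] := by simpa using hw
    simp
  | succ n ih =>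
    constructor
    · rintro ⟨h1, -, h3⟩
      have key : ∀ {u v : List A}, (∀ a, a ∈ u ↔ a ∈ v) →
          (∀ a s r s' r', u = s ++ a :: r → a ∉ s → v = s' ++ a :: r' → a ∉ s' →
            SubwordEquiv n r r') → ∀ w : List A, w.length ≤ n + 1 → w.Sublist u →
            w.Sublist v := by
        intro u v h1 h3 w hw hwu
        cases w with
        | nil => simp
        | cons a w =>
          have ha : a ∈ u := hwu.subset (by simp)
          obtain ⟨s, r, rfl, hs⟩ := exists_first_split ha
          obtain ⟨s', r', rfl, hs'⟩ := exists_first_split ((h1 a).1 ha)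
          rw [cons_sublist_first_split hs] at hwu
          rw [cons_sublist_first_split hs']
          exact (h3 a s r s' r' rfl hs rfl hs' w (by simpa using hw)).1 hwu
      have h4 : ∀ a s r s' r', u = s ++ a :: r → a ∉ s → v = s' ++ a :: r' → a ∉ s' →
            SubwordEquiv n r r' := fun a s r s' r' g1 g2 g3 g4 =>
        ih.1 (h3 a s r s' r' g1 g2 g3 g4).2
      exact fun w hw => ⟨key h1 h4 w hw, key (fun a => (h1 a).symm)
        (fun a s r s' r' g1 g2 g3 g4 w hw => (h4 a s' r' s r g3 g4 g1 g2 w hw).symm) w hw⟩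
    · intro h
      exact ⟨h.mem_iff, ListX.zero_right _ _ _, fun a s r s' r' g1 g2 g3 g4 =>
        ⟨ListX.zero_right _ _ _, ih.2 (h.first_right g1 g2 g3 g4)⟩⟩

theorem cSplit_iff_not_sublist {u : List A} {a b : A} :
    CSplit u a b ↔ a ≠ b ∧ a ∈ u ∧ b ∈ u ∧ ¬ [a, b].Sublist u := by
  rw [cSplit_iff]
  constructor
  · rintro ⟨hab, hb, s, r, rfl, hs, hr⟩
    refine ⟨hab, by simp, hb, ?_⟩
    rw [cons_sublist_first_split hs]
    simpa using hr
  · rintro ⟨hab, ha, hb, h⟩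
    obtain ⟨s, r, rfl, hs⟩ := exists_first_split ha
    rw [cons_sublist_first_split hs] at h
    exact ⟨hab, hb, s, r, rfl, hs, by simpa using h⟩

theorem SubwordEquiv.listW {n : ℕ} {u v : List A} (h : SubwordEquiv (n + 1) u v) :
    ListW n 1 u v := by
  induction n generalizing u v with
  | zero => exact ListW.zero_left _ _ _
  | succ n ih =>
    refine ⟨h.mem_iff, ?_, ?_, fun a b => ?_, fun _ _ _ _ _ _ _ _ _ _ _ _ _ _ =>
      ListW.zero_right _ _ _⟩
    · intro a s r s' r' g1 g2 g3 g4
      exact ⟨ListW.zero_right _ _ _, ih (h.first_right g1 g2 g3 g4)⟩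
    · intro a s r s' r' g1 g2 g3 g4
      refine ⟨ih ?_, ListW.zero_right _ _ _⟩
      simpa using (h.reverse.first_right (reverse_split g1) (by simpa using g2)
        (reverse_split g3) (by simpa using g4)).reverse
    · rw [cSplit_iff_not_sublist, cSplit_iff_not_sublist, h.mem_iff a, h.mem_iff b,
        h [a, b] (by simp)]

/-! ### Absorption -/

theorem ListX.absorb {B : Set A} {n m : ℕ} {u v : List A} {L : List (List A)} (q : List A)
    (hn : n ≤ L.length) (hL : ∀ l ∈ L, ∀ a, a ∈ l ↔ a ∈ B) (hu : ∀ a ∈ u, a ∈ B)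
    (hv : ∀ a ∈ v, a ∈ B) (h : ListX n m u.reverse v.reverse) :
    ListX n (m + 1) (q ++ L.flatten ++ u) (q ++ L.flatten ++ v) := by
  induction n generalizing q L with
  | zero => exact zero_left _ _ _
  | succ n ih =>
    cases L with
    | nil => simp at hn
    | cons l L =>
      have hl := hL l (by simp)
      refine ⟨fun a => ?_, ?_, ?_⟩
      · have := hl a
        have := hu a
        have := hv a
        simp only [List.flatten_cons, List.mem_append]
        tauto
      · simpa using (h.mono (by omega) le_rfl).append (refl n m (q ++ (l :: L).flatten).reverse)
      · intro a s r s' r' g1 g2 g3 g4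
        have ha : a ∈ q ++ l := by
          by_contra hc
          have hq : a ∉ q := fun h => hc (by simp [h])
          have hB : a ∉ B := fun h => hc (by simp [(hl a).2 h])
          have h1 : a ∈ q ++ (l :: L).flatten ++ u := by rw [g1]; simp
          rw [List.mem_append, List.mem_append, List.mem_flatten] at h1
          rcases h1 with (h1 | ⟨l', h1, h2⟩) | h1
          · exact hq h1
          · exact hB ((hL l' h1 a).1 h2)
          · exact hB (hu a h1)
        obtain ⟨t, z, htz, ht⟩ := exists_first_split ha
        have key : ∀ {w s r : List A}, q ++ (l :: L).flatten ++ w = s ++ a :: r → a ∉ s →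
            t = s ∧ z ++ L.flatten ++ w = r := by
          intro w s r g1 g2
          have h2 : t ++ a :: (z ++ L.flatten ++ w) = s ++ a :: r := by
            rw [← g1]
            simp [← List.append_assoc, htz]
            simp
          exact first_split_unique h2 ht g2
        obtain ⟨rfl, rfl⟩ := key g1 g2
        obtain ⟨rfl, rfl⟩ := key g3 g4
        exact ⟨refl _ _ _, ih z (by simpa using hn) (fun l' hl' => hL l' (by simp [hl']))
          (h.mono (by omega) le_rfl)⟩

/-! ### Finite index -/

theorem ListX.exists_finite_invariant [Finite A] (n m : ℕ) :
    ∃ (F : Type) (_ : Finite F) (c : List A → F), ∀ u v, c u = c v → ListX n m u v := by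
  induction n generalizing m with
  | zero => exact ⟨Unit, inferInstance, fun _ => (), fun _ _ _ => zero_left _ _ _⟩
  | succ n ih =>
    cases m with
    | zero => exact ⟨Unit, inferInstance, fun _ => (), fun _ _ _ => zero_right _ _ _⟩
    | succ m =>
      obtain ⟨F, _, c, hc⟩ := ih m
      obtain ⟨G, _, d, hd⟩ := ih (m + 1)
      refine ⟨Set A × F × (A → F → G → Prop), inferInstance, fun u => ({a | a ∈ u}, c u.reverse,
        fun a x y => ∃ s r, u = s ++ a :: r ∧ a ∉ s ∧ c s.reverse = x ∧ d r = y), ?_⟩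
      intro u v h
      simp only [Prod.mk.injEq] at h
      obtain ⟨h1, h2, h3⟩ := h
      refine ⟨fun a => Set.ext_iff.1 h1 a, hc _ _ h2, ?_⟩
      intro a s r s' r' g1 g2 g3 g4
      have h4 := congrFun (congrFun (congrFun h3 a) (c s.reverse)) (d r)
      obtain ⟨t, z, h5, h6, h7, h8⟩ := h4.mp ⟨s, r, g1, g2, rfl, rfl⟩
      obtain ⟨rfl, rfl⟩ := first_split_unique (g3.symm.trans h5) g4 h6
      exact ⟨hc _ _ h7.symm, hd _ _ h8.symm⟩

end Comparison

namespace GWord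

variable {A : Type}

/-- The map `f` identifies the generalized word `u` with the list `l`. -/
structure ReprBy (u : GWord A) (l : List A) (f : u.P → ℕ) : Prop where
  strictMono : StrictMono f
  label : ∀ p, l[f p]? = some (u.w p)
  surj : ∀ i < l.length, ∃ p, f p = i

/-- The generalized word `u` is isomorphic to the list `l`. -/
def Represents (u : GWord A) (l : List A) : Prop := ∃ f, ReprBy u l f

theorem represents_ofList (l : List A) : (ofList l).Represents l := by
  refine ⟨fun i : Fin l.length => (i : ℕ), ?_, ?_, ?_⟩
  · intro i j h
    exact h
  · intro i
    exact List.getElem?_eq_getElem (show Fin l.length from i).2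
  · intro i hi
    exact ⟨(⟨i, hi⟩ : Fin l.length), rfl⟩

namespace ReprBy

variable {u : GWord A} {l : List A} {f : u.P → ℕ}

theorem lt_length (h : ReprBy u l f) (p : u.P) : f p < l.length :=
  (List.getElem?_eq_some_iff.1 (h.label p)).1

theorem mem_alph (h : ReprBy u l f) (a : A) : a ∈ u.alph ↔ a ∈ l := by
  rw [List.mem_iff_getElem?]
  constructor
  · rintro ⟨p, rfl⟩
    exact ⟨f p, h.label p⟩
  · rintro ⟨i, hi⟩
    obtain ⟨p, rfl⟩ := h.surj i (List.getElem?_eq_some_iff.1 hi).1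
    rw [h.label p] at hi
    exact ⟨p, Option.some_injective _ hi⟩

theorem restrict (h : ReprBy u l f) {l₁ l₂ l₃ : List A} (hl : l = l₁ ++ l₂ ++ l₃) (s : Set u.P)
    (hs : ∀ p, p ∈ s ↔ l₁.length ≤ f p ∧ f p < l₁.length + l₂.length) :
    (u.restrict s).Represents l₂ := by
  subst hl
  refine ⟨fun p : {p // p ∈ s} => f p.1 - l₁.length, ?_, ?_, ?_⟩
  · rintro ⟨p, hp⟩ ⟨q, hq⟩ hpq
    have h1 : f p < f q := h.strictMono hpq
    have h2 := (hs p).1 hp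
    simp only
    omega
  · rintro ⟨p, hp⟩
    have h1 := h.label p
    have h2 := (hs p).1 hp
    rw [List.append_assoc, List.getElem?_append_right h2.1,
      List.getElem?_append_left (by omega)] at h1
    exact h1
  · intro i hi
    obtain ⟨p, hp⟩ := h.surj (l₁.length + i) (by simp; omega)
    exact ⟨⟨p, (hs p).2 (by omega)⟩, by simp [hp]⟩

theorem eq_of_label (h : ReprBy u l f) {s r : List A} {a : A} (hl : l = s ++ a :: r) {p : u.P}
    (hp : f p = s.length) : u.w p = a := by
  have h1 := h.label p
  rw [hp, hl] at h1
  simpa using h1.symm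

theorem exists_pos (h : ReprBy u l f) {s r : List A} {a : A} (hl : l = s ++ a :: r) :
    ∃ p, f p = s.length := h.surj _ (by simp [hl])

theorem le_of_label (h : ReprBy u l f) {s r : List A} {a : A} (hl : l = s ++ a :: r)
    (hs : a ∉ s) {p : u.P} (hp : u.w p = a) : s.length ≤ f p := by
  by_contra hc
  have h1 := h.label p
  rw [hl, List.getElem?_append_left (by omega), hp] at h1
  exact hs (List.mem_of_getElem? h1)

theorem ge_of_label (h : ReprBy u l f) {s r : List A} {a : A} (hl : l = s ++ a :: r)
    (hr : a ∉ r) {p : u.P} (hp : u.w p = a) : f p ≤ s.length := by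
  by_contra hc
  have h1 := h.label p
  rw [hl, List.append_cons, List.getElem?_append_right (by simp; omega), hp] at h1
  exact hr (List.mem_of_getElem? h1)

theorem isFirst_iff (h : ReprBy u l f) {s r : List A} {a : A} (hl : l = s ++ a :: r)
    (hs : a ∉ s) (p : u.P) : u.IsFirst a p ↔ f p = s.length := by
  constructor
  · rintro ⟨h1, h2⟩
    obtain ⟨q, hq⟩ := h.exists_pos hl
    have h3 := h.strictMono.monotone (h2 q (h.eq_of_label hl hq))
    have h4 := h.le_of_label hl hs h1
    omega
  · intro hp
    refine ⟨h.eq_of_label hl hp, fun q hq => ?_⟩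
    rw [← h.strictMono.le_iff_le, hp]
    exact h.le_of_label hl hs hq

theorem isLast_iff (h : ReprBy u l f) {s r : List A} {a : A} (hl : l = s ++ a :: r)
    (hr : a ∉ r) (p : u.P) : u.IsLast a p ↔ f p = s.length := by
  constructor
  · rintro ⟨h1, h2⟩
    obtain ⟨q, hq⟩ := h.exists_pos hl
    have h3 := h.strictMono.monotone (h2 q (h.eq_of_label hl hq))
    have h4 := h.ge_of_label hl hr h1
    omega
  · intro hp
    refine ⟨h.eq_of_label hl hp, fun q hq => ?_⟩
    rw [← h.strictMono.le_iff_le, hp]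
    exact h.ge_of_label hl hr hq

theorem left_of (h : ReprBy u l f) {s r : List A} {a : A} (hl : l = s ++ a :: r) {p : u.P}
    (hp : f p = s.length) : (u.restrict {q | q < p}).Represents s := by
  refine h.restrict (l₁ := []) (l₃ := a :: r) (by simp [hl]) _ fun q => ?_
  rw [Set.mem_ofPred_eq, ← h.strictMono.lt_iff_lt, hp]
  simp

theorem right_of (h : ReprBy u l f) {s r : List A} {a : A} (hl : l = s ++ a :: r) {p : u.P}
    (hp : f p = s.length) : (u.restrict {q | p < q}).Represents r := by
  refine h.restrict (l₁ := s ++ [a]) (l₃ := []) (by simp [hl]) _ fun q => ?_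
  have h1 := h.lt_length q
  rw [Set.mem_ofPred_eq, ← h.strictMono.lt_iff_lt, hp]
  simp only [hl, List.length_append, List.length_cons, List.length_nil] at h1 ⊢
  omega

end ReprBy

namespace Represents

variable {u : GWord A} {l : List A}

theorem mem_alph (h : u.Represents l) (a : A) : a ∈ u.alph ↔ a ∈ l := by
  obtain ⟨f, h⟩ := h
  exact h.mem_alph a

theorem alph_eq_iff (h : u.Represents l) {v : GWord A} {k : List A} (h' : v.Represents k) :
    u.alph = v.alph ↔ ∀ a, a ∈ l ↔ a ∈ k := by
  simp only [Set.ext_iff, h.mem_alph, h'.mem_alph]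

theorem first (h : u.Represents l) {s r : List A} {a : A} (hl : l = s ++ a :: r)
    (hs : a ∉ s) : (u.XL a).Represents s ∧ (u.XR a).Represents r := by
  obtain ⟨f, h⟩ := h
  have hex : ∃ p, u.IsFirst a p :=
    (h.exists_pos hl).imp fun p hp => (h.isFirst_iff hl hs p).2 hp
  have hp := (h.isFirst_iff hl hs _).1 hex.choose_spec
  rw [XL, XR, dif_pos hex, dif_pos hex]
  exact ⟨h.left_of hl hp, h.right_of hl hp⟩

theorem last (h : u.Represents l) {s r : List A} {a : A} (hl : l = s ++ a :: r)
    (hr : a ∉ r) : (u.YL a).Represents s ∧ (u.YR a).Represents r := by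
  obtain ⟨f, h⟩ := h
  have hex : ∃ p, u.IsLast a p :=
    (h.exists_pos hl).imp fun p hp => (h.isLast_iff hl hr p).2 hp
  have hp := (h.isLast_iff hl hr _).1 hex.choose_spec
  rw [YL, YR, dif_pos hex, dif_pos hex]
  exact ⟨h.left_of hl hp, h.right_of hl hp⟩

theorem cDefined_iff (h : u.Represents l) (a b : A) : u.CDefined a b ↔ CSplit l a b := by
  obtain ⟨f, h⟩ := h
  constructor
  · rintro ⟨p, q, hp, hq, hqp⟩
    obtain ⟨s, r, hl, hs⟩ := exists_first_split ((h.mem_alph a).1 ⟨p, hp.1⟩)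
    obtain ⟨s', r', hl', hr'⟩ := exists_last_split ((h.mem_alph b).1 ⟨q, hq.1⟩)
    have h1 := (h.isFirst_iff hl hs p).1 hp
    have h2 := (h.isLast_iff hl' hr' q).1 hq
    have h3 := h.strictMono hqp
    rw [cSplit_iff]
    refine ⟨?_, by simp [hl'], s, r, hl, hs, ?_⟩
    · rintro rfl
      have h4 := h.strictMono.monotone (hp.2 q hq.1)
      omega
    · intro hb
      obtain ⟨t, z, rfl⟩ := List.append_of_mem hb
      obtain ⟨x, hx⟩ := h.surj (s.length + 1 + t.length) (by simp [hl]; omega)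
      have h4 : u.w x = b := h.eq_of_label (s := s ++ a :: t) (r := z) (by simp [hl])
        (by simp [hx]; omega)
      have h5 := h.strictMono.monotone (hq.2 x h4)
      omega
  · rintro ⟨s, t, r, hl, h1, h2⟩
    have hl' : l = (s ++ b :: t) ++ a :: r := by simp [hl]
    obtain ⟨p, hp⟩ := h.exists_pos hl'
    obtain ⟨q, hq⟩ := h.exists_pos hl
    refine ⟨p, q, (h.isFirst_iff hl' h1 p).2 hp, (h.isLast_iff hl h2 q).2 hq, ?_⟩
    rw [← h.strictMono.lt_iff_lt, hp, hq]
    simp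

theorem cab (h : u.Represents l) {s t r : List A} {a b : A} (hl : l = s ++ b :: (t ++ a :: r))
    (h1 : a ∉ s ++ b :: t) (h2 : b ∉ t ++ a :: r) : (u.Cab a b).Represents t := by
  have hC : u.CDefined a b := (h.cDefined_iff a b).2 ⟨s, t, r, hl, h1, h2⟩
  obtain ⟨f, h⟩ := h
  have hl' : l = (s ++ b :: t) ++ a :: r := by simp [hl]
  obtain ⟨h3, h4, h5⟩ := hC.choose_spec.choose_spec
  have h6 := (h.isFirst_iff hl' h1 _).1 h3
  have h7 := (h.isLast_iff hl h2 _).1 h4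
  rw [Cab, dif_pos hC]
  refine h.restrict (l₁ := s ++ [b]) (l₃ := a :: r) (by simp [hl]) _ fun q => ?_
  rw [Set.mem_ofPred_eq, ← h.strictMono.lt_iff_lt, ← h.strictMono.lt_iff_lt, h6, h7]
  simp
  omega

end Represents

end GWord

section Translation

variable {A : Type}

open GWord

theorem eqvAux_zero_left (k : ZK) (m : ℕ) (u v : GWord A) : eqvAux 0 k m u v := by
  cases k <;> cases m <;> trivial

theorem eqvAux_zero_right (k : ZK) (n : ℕ) (u v : GWord A) : eqvAux n k 0 u v := by
  cases k <;> cases n <;> trivial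

theorem eqvAux_X_Y_iff {n m : ℕ} {u v : GWord A} {l k : List A} (hu : u.Represents l)
    (hv : v.Represents k) : (eqvAux n ZK.X m u v ↔ ListX n m l k) ∧
      (eqvAux n ZK.Y m u v ↔ ListX n m l.reverse k.reverse) := by
  induction n generalizing m u v l k with
  | zero => simp [eqvAux_zero_left, ListX.zero_left]
  | succ n ih =>
    cases m with
    | zero => simp [eqvAux_zero_right, ListX.zero_right]
    | succ m =>
      constructor
      · rw [eqvAux, ListX, hu.alph_eq_iff hv, (ih hu hv).2]
        refine and_congr_right fun h1 => and_congr_right fun _ => ⟨?_, ?_⟩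
        · intro h a s r s' r' g1 g2 g3 g4
          obtain ⟨i1, i2⟩ := h a ((hu.mem_alph a).2 (by simp [g1]))
          exact ⟨(ih (hu.first g1 g2).1 (hv.first g3 g4).1).2.1 i1,
            (ih (hu.first g1 g2).2 (hv.first g3 g4).2).1.1 i2⟩
        · intro h a ha
          obtain ⟨s, r, g1, g2⟩ := exists_first_split ((hu.mem_alph a).1 ha)
          obtain ⟨s', r', g3, g4⟩ := exists_first_split ((h1 a).1 (by simp [g1]))
          obtain ⟨i1, i2⟩ := h a s r s' r' g1 g2 g3 g4
          exact ⟨(ih (hu.first g1 g2).1 (hv.first g3 g4).1).2.2 i1,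
            (ih (hu.first g1 g2).2 (hv.first g3 g4).2).1.2 i2⟩
      · rw [eqvAux, ListX, hu.alph_eq_iff hv, (ih hu hv).1]
        simp only [List.reverse_reverse, List.mem_reverse]
        refine and_congr_right fun h1 => and_congr_right fun _ => ⟨?_, ?_⟩
        · intro h a r s r' s' g1 g2 g3 g4
          have g1' := reverse_split g1
          have g3' := reverse_split g3
          rw [List.reverse_reverse] at g1' g3'
          have g2' : a ∉ r.reverse := by simpa using g2
          have g4' : a ∉ r'.reverse := by simpa using g4
          obtain ⟨i1, i2⟩ := h a ((hu.mem_alph a).2 (by simp [g1']))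
          refine ⟨(ih (hu.last g1' g2').2 (hv.last g3' g4').2).1.1 i2, ?_⟩
          simpa using (ih (hu.last g1' g2').1 (hv.last g3' g4').1).2.1 i1
        · intro h a ha
          obtain ⟨s, r, g1, g2⟩ := exists_last_split ((hu.mem_alph a).1 ha)
          obtain ⟨s', r', g3, g4⟩ := exists_last_split ((h1 a).1 (by simp [g1]))
          obtain ⟨i1, i2⟩ := h a _ _ _ _ (reverse_split g1) (by simpa using g2)
            (reverse_split g3) (by simpa using g4)
          exact ⟨(ih (hu.last g1 g2).1 (hv.last g3 g4).1).2.2 i2,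
            (ih (hu.last g1 g2).2 (hv.last g3 g4).2).1.2 (by simpa using i1)⟩

theorem eqvAux_WI_iff {n m : ℕ} {u v : GWord A} {l k : List A} (hu : u.Represents l)
    (hv : v.Represents k) : eqvAux n ZK.WI m u v ↔ ListW n m l k := by
  induction n generalizing m u v l k with
  | zero => simp [eqvAux_zero_left, ListW.zero_left]
  | succ n ih =>
    cases m with
    | zero => simp [eqvAux_zero_right, ListW.zero_right]
    | succ m =>
      rw [eqvAux, ListW, hu.alph_eq_iff hv]
      refine and_congr_right fun hlk => ?_
      constructor
      · rintro ⟨h1, h2⟩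
        refine ⟨?_, ?_, ?_, ?_⟩
        · intro a s r s' r' g1 g2 g3 g4
          obtain ⟨i1, i2, -, -⟩ := h1 a ((hu.mem_alph a).2 (by simp [g1]))
          exact ⟨(ih (hu.first g1 g2).1 (hv.first g3 g4).1).1 i1,
            (ih (hu.first g1 g2).2 (hv.first g3 g4).2).1 i2⟩
        · intro a s r s' r' g1 g2 g3 g4
          obtain ⟨-, -, i1, i2⟩ := h1 a ((hu.mem_alph a).2 (by simp [g1]))
          exact ⟨(ih (hu.last g1 g2).1 (hv.last g3 g4).1).1 i1,
            (ih (hu.last g1 g2).2 (hv.last g3 g4).2).1 i2⟩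
        · intro a b
          by_cases hab : a ∈ l ∧ b ∈ l
          · rw [← hu.cDefined_iff, ← hv.cDefined_iff]
            exact (h2 a ((hu.mem_alph a).2 hab.1) b ((hu.mem_alph b).2 hab.2)).1
          · simp only [cSplit_iff_not_sublist, ← hlk]
            tauto
        · intro a b s t r s' t' r' g1 g2 g3 g4 g5 g6
          exact (ih (hu.cab g1 g2 g3) (hv.cab g4 g5 g6)).1 <|
            (h2 a ((hu.mem_alph a).2 (by simp [g1])) b ((hu.mem_alph b).2 (by simp [g1]))).2
            ((hu.cDefined_iff a b).2 ⟨s, t, r, g1, g2, g3⟩)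
            ((hv.cDefined_iff a b).2 ⟨s', t', r', g4, g5, g6⟩)
      · rintro ⟨h1, h2, h3, h4⟩
        refine ⟨fun a ha => ?_, fun a _ b _ => ⟨?_, fun hc hc' => ?_⟩⟩
        · obtain ⟨s, r, g1, g2⟩ := exists_first_split ((hu.mem_alph a).1 ha)
          obtain ⟨s', r', g3, g4⟩ := exists_first_split ((hlk a).1 (by simp [g1]))
          obtain ⟨t, q, k1, k2⟩ := exists_last_split ((hu.mem_alph a).1 ha)
          obtain ⟨t', q', k3, k4⟩ := exists_last_split ((hlk a).1 (by simp [g1]))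
          obtain ⟨i1, i2⟩ := h1 a s r s' r' g1 g2 g3 g4
          obtain ⟨i3, i4⟩ := h2 a t q t' q' k1 k2 k3 k4
          exact ⟨(ih (hu.first g1 g2).1 (hv.first g3 g4).1).2 i1,
            (ih (hu.first g1 g2).2 (hv.first g3 g4).2).2 i2,
            (ih (hu.last k1 k2).1 (hv.last k3 k4).1).2 i3,
            (ih (hu.last k1 k2).2 (hv.last k3 k4).2).2 i4⟩
        · rw [hu.cDefined_iff, hv.cDefined_iff]
          exact h3 a b
        · obtain ⟨s, t, r, g1, g2, g3⟩ := (hu.cDefined_iff a b).1 hc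
          obtain ⟨s', t', r', g4, g5, g6⟩ := (hv.cDefined_iff a b).1 hc'
          exact (ih (hu.cab g1 g2 g3) (hv.cab g4 g5 g6)).2
            (h4 a b s t r s' t' r' g1 g2 g3 g4 g5 g6)

theorem wEquiv_X_iff {m n : ℕ} {l k : List A} :
    wEquiv ZKind.X m n (ofList l) (ofList k) ↔ ListX n m l k :=
  (eqvAux_X_Y_iff (represents_ofList l) (represents_ofList k)).1

theorem wEquiv_Y_iff {m n : ℕ} {l k : List A} :
    wEquiv ZKind.Y m n (ofList l) (ofList k) ↔ ListX n m l.reverse k.reverse :=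
  (eqvAux_X_Y_iff (represents_ofList l) (represents_ofList k)).2

theorem wEquiv_XY_iff {m n : ℕ} {l k : List A} :
    wEquiv ZKind.XY m n (ofList l) (ofList k) ↔
      ListX n m l k ∧ ListX n m l.reverse k.reverse :=
  and_congr wEquiv_X_iff wEquiv_Y_iff

theorem wEquiv_WI_iff {m n : ℕ} {l k : List A} :
    wEquiv ZKind.WI m n (ofList l) (ofList k) ↔ ListW n m l k :=
  eqvAux_WI_iff (represents_ofList l) (represents_ofList k)

end Translation

section FiniteMonoids

open MulOpposite

theorem exists_isIdempotentElem_pow {M : Type} [Monoid M] [Finite M] (x : M) :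
    ∃ n, IsIdempotentElem (x ^ (n + 1)) := by
  obtain ⟨i, j, hij, h⟩ := Finite.exists_ne_map_eq_of_infinite (fun n : ℕ => x ^ n)
  wlog hlt : i < j generalizing i j
  · exact this j i hij.symm h.symm (by omega)
  obtain ⟨d, rfl⟩ := Nat.exists_eq_add_of_lt hlt
  have hp : ∀ c, x ^ (i + c * (d + 1)) = x ^ i := by
    intro c
    induction c with
    | zero => simp
    | succ c ih =>
      rw [show i + (c + 1) * (d + 1) = (i + c * (d + 1)) + (d + 1) by ring, pow_add, ih, ← pow_add]
      exact h.symm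
  have hq : ∀ k c, i ≤ k → x ^ (k + c * (d + 1)) = x ^ k := by
    intro k c hk
    obtain ⟨l, rfl⟩ := Nat.exists_eq_add_of_le hk
    rw [show i + l + c * (d + 1) = (i + c * (d + 1)) + l by ring, pow_add, hp, ← pow_add]
  refine ⟨i * (d + 1) + d, ?_⟩
  rw [IsIdempotentElem, ← pow_add,
    show i * (d + 1) + d + 1 + (i * (d + 1) + d + 1) =
      i * (d + 1) + d + 1 + (i + 1) * (d + 1) by ring]
  exact hq _ _ (by nlinarith)

section Stable

variable {M : Type} [Monoid M]

/-- Right multiplication of `P` by `x` stays in the `R`-class of `P`. -/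
def RStable (P x : M) : Prop := ∃ z, P * x * z = P

/-- Left multiplication of `Q` by `x` stays in the `L`-class of `Q`. -/
def LStable (Q x : M) : Prop := ∃ z, z * (x * Q) = Q

theorem lStable_iff {Q x : M} : LStable Q x ↔ RStable (op Q) (op x) := by
  constructor
  · rintro ⟨z, hz⟩
    exact ⟨op z, by rw [← op_mul, ← op_mul, hz]⟩
  · rintro ⟨z, hz⟩
    exact ⟨unop z, by simpa using congrArg unop hz⟩

theorem RStable.one (P : M) : RStable P 1 := ⟨1, by simp⟩

/-- The elementwise form of `∼_K`, valid for every `P` and not just for idempotents. -/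
def KRel (x y : M) : Prop := ∀ P, RStable P x ∨ RStable P y → P * x = P * y

theorem KRel.symm {x y : M} (h : KRel x y) : KRel y x := fun P hP => (h P hP.symm).symm

theorem KRel.rStable {x y : M} (h : KRel x y) {P : M} (hx : RStable P x) : RStable P y := by
  have h1 := h P (Or.inl hx)
  obtain ⟨z, hz⟩ := hx
  exact ⟨z, by rw [← h1, hz]⟩

theorem rGreen_mul_iff {e x : M} : rGreen (e * x) e ↔ RStable e x := by
  constructor
  · intro h
    obtain ⟨z, hz⟩ : e ∈ Set.range (fun z => e * x * z) := by
      rw [h]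
      exact ⟨1, by simp⟩
    exact ⟨z, hz⟩
  · rintro ⟨z, hz⟩
    ext w
    constructor
    · rintro ⟨t, rfl⟩
      exact ⟨x * t, by simp [mul_assoc]⟩
    · rintro ⟨t, rfl⟩
      exact ⟨z * t, by simp only [← mul_assoc, hz]⟩

theorem KRel.simK {x y : M} (h : KRel x y) : simK x y := by
  intro e _ he
  rw [rGreen_mul_iff, rGreen_mul_iff] at he
  exact h e he

theorem simK.kRel [Finite M] {x y : M} (h : simK x y) : KRel x y := by
  have key : ∀ {x y : M}, _root_.simK x y → ∀ P, RStable P x → P * x = P * y := by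
    rintro x y h P ⟨z, hz⟩
    obtain ⟨n, hn⟩ := exists_isIdempotentElem_pow (x * z)
    have hP : ∀ k, P * (x * z) ^ k = P := by
      intro k
      induction k with
      | zero => simp
      | succ k ih => rw [pow_succ, ← mul_assoc, ih, ← mul_assoc, hz]
    have h1 := h ((x * z) ^ (n + 1)) hn (Or.inl (rGreen_mul_iff.2
      ⟨z * (x * z) ^ n, by
        rw [mul_assoc, ← mul_assoc x, ← pow_succ']
        exact hn⟩))
    rw [← hP (n + 1), mul_assoc, mul_assoc, h1]
  rintro P (hP | hP)
  · exact key h P hP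
  · exact (key (fun e he hh => (h e he hh.symm).symm) P hP).symm

/-- `KRel` as a congruence. -/
def kRelCon (M : Type) [Monoid M] : Con M where
  r := KRel
  iseqv := by
    refine ⟨fun _ _ _ => rfl, KRel.symm, fun {x y w} h1 h2 P hP => ?_⟩
    rcases hP with hP | hP
    · rw [h1 P (Or.inl hP), h2 P (Or.inl (h1.rStable hP))]
    · rw [h1 P (Or.inr (h2.symm.rStable hP)), h2 P (Or.inr hP)]
  mul' := by
    have key : ∀ {x y x' y' : M}, KRel x y → KRel x' y' → ∀ P, RStable P (x * x') →
        P * (x * x') = P * (y * y') := by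
      rintro x y x' y' h1 h2 P ⟨z, hz⟩
      have e1 := h1 P (Or.inl ⟨x' * z, by simpa only [mul_assoc] using hz⟩)
      have e2 := h2 (P * x) (Or.inl ⟨z * x, by
        simpa only [mul_assoc] using congrArg (· * x) hz⟩)
      rw [← mul_assoc, e2, e1, mul_assoc]
    rintro x y x' y' h1 h2 P (hP | hP)
    · exact key h1 h2 P hP
    · exact (key h1.symm h2.symm P hP).symm

theorem kCon_of_kRel {x y : M} (h : KRel x y) : KCon M x y := ConGen.Rel.of _ _ h.simK

theorem kCon_iff_kRel [Finite M] {x y : M} : KCon M x y ↔ KRel x y := by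
  refine ⟨fun h => ?_, kCon_of_kRel⟩
  have : KCon M ≤ kRelCon M := Con.conGen_le.2 fun _ _ h => simK.kRel h
  exact this h

end Stable

instance finite_con_quotient {M : Type} [Monoid M] [Finite M] (c : Con M) : Finite c.Quotient :=
  Quotient.finite _

instance finite_mulOpposite {M : Type} [Finite M] : Finite Mᵐᵒᵖ :=
  Finite.of_equiv M opEquiv

theorem IsJTrivial.eq_of_mul {M : Type} [Monoid M] (h : IsJTrivial M) {x y a b c d : M}
    (h1 : a * x * b = y) (h2 : c * y * d = x) : x = y := by
  apply h
  ext z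
  constructor
  · rintro ⟨s, t, rfl⟩
    exact ⟨s * c, d * t, by rw [← h2]; simp only [mul_assoc]⟩
  · rintro ⟨s, t, rfl⟩
    exact ⟨s * a, b * t, by rw [← h1]; simp only [mul_assoc]⟩

theorem isJTrivial_of_mul {M : Type} [Monoid M]
    (h : ∀ x y a b c d : M, a * x * b = y → c * y * d = x → x = y) : IsJTrivial M := by
  intro x y hxy
  obtain ⟨a, b, h1⟩ : y ∈ {z | ∃ a b, z = a * x * b} := by
    rw [hxy]
    exact ⟨1, 1, by simp⟩
  obtain ⟨c, d, h2⟩ : x ∈ {z | ∃ a b, z = a * y * b} := by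
    rw [← hxy]
    exact ⟨1, 1, by simp⟩
  exact h x y a b c d h1.symm h2.symm

theorem IsJTrivial.op {M : Type} [Monoid M] (h : IsJTrivial M) : IsJTrivial Mᵐᵒᵖ := by
  refine isJTrivial_of_mul fun x y a b c d h1 h2 => ?_
  refine unop_injective (h.eq_of_mul (a := unop b) (b := unop a) (c := unop d) (d := unop c) ?_ ?_)
  · rw [← h1]; simp [mul_assoc]
  · rw [← h2]; simp [mul_assoc]

/-- `RLevel k M` says that `M` lies in the class `R_{k+1}`, with the classes `L_j` expressed
through opposite monoids. -/
def RLevel : ∀ (_ : ℕ) (M : Type) [Monoid M], Prop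
  | 0, M, _ => IsJTrivial M
  | k + 1, M, _ => RLevel k ((KCon M).Quotient)ᵐᵒᵖ

theorem mul_pow_mul_eq_self {M : Type} [Monoid M] {x s t : M} (h : s * x * t = x) (n : ℕ) :
    s ^ n * x * t ^ n = x := by
  induction n with
  | zero => simp
  | succ n ih =>
    rw [pow_succ, pow_succ', show s ^ n * s * x * (t * t ^ n) = s ^ n * (s * x * t) * t ^ n by
      simp only [mul_assoc], h, ih]

theorem IsJTrivial.idem_mul_eq {M : Type} [Monoid M] (h : IsJTrivial M) {e x y : M}
    (he : e * x * y = e) : e * x = e :=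
  (h.eq_of_mul (a := 1) (b := x) (c := 1) (d := y) (by simp) (by simpa using he)).symm

theorem IsJTrivial.mul_idem_eq {M : Type} [Monoid M] (h : IsJTrivial M) {e x y : M}
    (he : y * (x * e) = e) : x * e = e :=
  (h.eq_of_mul (a := x) (b := 1) (c := y) (d := 1) (by simp) (by simpa using he)).symm

/-- `RLevel k` is closed under division, in the form of a comparison of kernels. -/
theorem RLevel.of_kernel {k : ℕ} {T M N : Type} [Monoid T] [Monoid M] [Monoid N] [Finite M]
    (f : T →* N) (g : T →* M) (hf : Function.Surjective f)
    (hfg : ∀ x y, g x = g y → f x = f y) (hM : RLevel k M) : RLevel k N := by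
  induction k generalizing T M N with
  | zero =>
    refine isJTrivial_of_mul fun x y a b c d h1 h2 => ?_
    obtain ⟨x, rfl⟩ := hf x
    obtain ⟨a, rfl⟩ := hf a
    obtain ⟨b, rfl⟩ := hf b
    obtain ⟨c, rfl⟩ := hf c
    obtain ⟨d, rfl⟩ := hf d
    have hJ : IsJTrivial M := hM
    obtain ⟨n, hn⟩ := exists_isIdempotentElem_pow (g (c * a))
    obtain ⟨l, hl⟩ := exists_isIdempotentElem_pow (g (b * d))
    obtain ⟨q, hq⟩ : ∃ q, (n + 1) * (l + 1) = q + 1 := ⟨n * l + n + l, by ring⟩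
    have hn' : IsIdempotentElem (g (c * a) ^ ((n + 1) * (l + 1))) := by
      rw [pow_mul]; exact hn.pow _
    have hl' : IsIdempotentElem (g (b * d) ^ ((n + 1) * (l + 1))) := by
      rw [mul_comm, pow_mul]; exact hl.pow _
    rw [hq] at hn' hl'
    obtain ⟨X, hX⟩ : ∃ X, X = (c * a) ^ (q + 1) * x * (b * d) ^ (q + 1) := ⟨_, rfl⟩
    have e1 : g (c * a) * g (c * a) ^ (q + 1) = g (c * a) ^ (q + 1) := by
      refine hJ.mul_idem_eq (y := g (c * a) ^ q) ?_
      rw [← mul_assoc, ← pow_succ]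
      exact hn'
    have e2 : g (b * d) ^ (q + 1) * g (b * d) = g (b * d) ^ (q + 1) := by
      refine hJ.idem_mul_eq (y := g (b * d) ^ q) ?_
      rw [mul_assoc, ← pow_succ']
      exact hl'
    have hx : f X = f x := by
      rw [hX, map_mul, map_mul, map_pow, map_pow]
      refine mul_pow_mul_eq_self ?_ _
      rw [map_mul, map_mul]
      calc f c * f a * f x * (f b * f d) = f c * (f a * f x * f b) * f d := by
            simp only [mul_assoc]
        _ = f x := by rw [h1, h2]
    have key : g X = g (a * X * b) := by
      refine hJ.eq_of_mul (a := g a) (b := g b) (c := g c) (d := g d) (by simp) ?_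
      have : g c * g (a * X * b) * g d = (g (c * a) * g (c * a) ^ (q + 1)) * g x *
          (g (b * d) ^ (q + 1) * g (b * d)) := by
        simp only [hX, map_mul, map_pow, mul_assoc]
      rw [this, e1, e2, hX]
      simp only [map_mul, map_pow]
    have := hfg _ _ key
    rw [map_mul, map_mul, hx, h1] at this
    exact this
  | succ k ih =>
    refine ih (MonoidHom.op ((KCon N).mk'.comp f)) (MonoidHom.op ((KCon M).mk'.comp g)) ?_ ?_ hM
    · intro y
      induction y using MulOpposite.rec' with
      | h y =>
        obtain ⟨y, rfl⟩ := Con.mk'_surjective y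
        obtain ⟨x, rfl⟩ := hf y
        exact ⟨op x, rfl⟩
    · intro x y h
      induction x using MulOpposite.rec' with
      | h x =>
      induction y using MulOpposite.rec' with
      | h y =>
        have h1 : KRel (g x) (g y) := kCon_iff_kRel.1 ((Con.eq _).1 (op_injective h))
        refine congrArg op ((Con.eq _).2 (kCon_of_kRel ?_))
        have key : ∀ {x y : T}, KRel (g x) (g y) → ∀ P, RStable P (f x) →
            P * f x = P * f y := by
          rintro x y h P ⟨z, hz⟩
          obtain ⟨P, rfl⟩ := hf P
          obtain ⟨z, rfl⟩ := hf z
          obtain ⟨n, hn⟩ := exists_isIdempotentElem_pow (g (x * z))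
          have hP : f (P * (x * z) ^ (n + 1)) = f P := by
            rw [map_mul, map_pow]
            have := mul_pow_mul_eq_self (x := f P) (s := 1) (t := f (x * z))
              (by simpa [mul_assoc] using hz) (n + 1)
            simpa using this
          have h2 := h (g (P * (x * z) ^ (n + 1))) (Or.inl ⟨g (z * (x * z) ^ n), by
            have : g (P * (x * z) ^ (n + 1)) * g x * g (z * (x * z) ^ n) =
                g P * (g (x * z) ^ (n + 1) * g (x * z) ^ (n + 1)) := by
              rw [pow_succ' (g (x * z))]
              simp only [map_mul, map_pow, mul_assoc, pow_succ']
            rw [this, hn.eq, ← map_pow, ← map_mul]⟩)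
          rw [← map_mul, ← map_mul] at h2
          have h3 := hfg _ _ h2
          rwa [map_mul f, map_mul f _ y, hP] at h3
        rintro P (hP | hP)
        · exact key h1 P hP
        · exact (key h1.symm P hP).symm

theorem RLevel.of_mulEquiv {k : ℕ} {M N : Type} [Monoid M] [Monoid N] [Finite M] (e : M ≃* N)
    (hM : RLevel k M) : RLevel k N :=
  hM.of_kernel e.toMonoidHom (MonoidHom.id M) e.surjective fun _ _ h => congrArg e h

theorem simD_iff {M : Type} [Monoid M] {x y : M} : simD x y ↔ simK (op x) (op y) := by
  have h1 : ∀ x y : M, lGreen x y ↔ rGreen (op x) (op y) := by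
    intro x y
    have h2 : ∀ x : M, Set.range (fun z : Mᵐᵒᵖ => op x * z) =
        unop ⁻¹' Set.range (fun z => z * x) := by
      intro x
      ext w
      constructor
      · rintro ⟨z, rfl⟩
        exact ⟨unop z, by simp⟩
      · rintro ⟨z, hz⟩
        exact ⟨op z, unop_injective hz⟩
    rw [rGreen, h2, h2, lGreen]
    exact (Set.preimage_injective.2 unop_surjective).eq_iff.symm
  constructor
  · intro h e he hh
    have := h (unop e) (congrArg unop he) (by simpa [h1] using hh)
    exact unop_injective (by simpa using this)
  · intro h e he hh
    have := h (op e) (congrArg op he) (by simpa [h1] using hh)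
    exact op_injective (by simpa using this)

theorem inRLAux_iff {k : ℕ} {M : Type} [i : Monoid M] [Finite M] :
    (InRLAux k true M i ↔ RLevel k M) ∧ (InRLAux k false M i ↔ RLevel k Mᵐᵒᵖ) := by
  induction k generalizing M with
  | zero =>
    refine ⟨Iff.rfl, fun h => IsJTrivial.op h, fun h => ?_⟩
    have h' : IsJTrivial Mᵐᵒᵖ := h
    exact RLevel.of_mulEquiv (k := 0) (MulEquiv.opOp M).symm h'.op
  | succ k ih =>
    refine ⟨(ih (M := (KCon M).Quotient)).2, ((ih (M := (DCon M).Quotient)).1).trans ?_⟩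
    let f : M →* ((KCon Mᵐᵒᵖ).Quotient)ᵐᵒᵖ :=
      (MonoidHom.op (KCon Mᵐᵒᵖ).mk').comp (MulEquiv.opOp M).toMonoidHom
    have hf : Function.Surjective f := by
      intro y
      induction y using MulOpposite.rec' with
      | h y =>
        obtain ⟨y, rfl⟩ := Con.mk'_surjective y
        exact ⟨unop y, rfl⟩
    have h1 : ∀ x y, (DCon M).mk' x = (DCon M).mk' y → f x = f y := by
      intro x y h
      have h2 : DCon M ≤ Con.ker f := Con.conGen_le.2 fun x y h =>
        congrArg op ((Con.eq _).2 (ConGen.Rel.of _ _ (simD_iff.1 h)))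
      exact h2 ((Con.eq _).1 h)
    have h3 : ∀ x y, f x = f y → (DCon M).mk' x = (DCon M).mk' y := by
      intro x y h
      have h2 : KCon Mᵐᵒᵖ ≤ Con.ker (MonoidHom.op (DCon M).mk') := Con.conGen_le.2 fun x y h =>
        congrArg op ((Con.eq _).2 (ConGen.Rel.of _ _ (simD_iff.2 h)))
      exact op_injective (h2 ((Con.eq _).1 (op_injective h)))
    exact ⟨fun h => RLevel.of_kernel (k := k) f (DCon M).mk' hf h1 h,
      fun h => RLevel.of_kernel (k := k) (DCon M).mk' f Con.mk'_surjective h3 h⟩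

/-- The finite monoids satisfying this lie in `DA`. -/
def DAProp (M : Type) [Monoid M] : Prop :=
  ∀ e : M, IsIdempotentElem e → ∀ x a y, e = x * a * y → e * a * e = e

theorem DAProp.op {M : Type} [Monoid M] (h : DAProp M) : DAProp Mᵐᵒᵖ := by
  intro e he x a y hxy
  have := h (unop e) (congrArg unop he) (unop y) (unop a) (unop x)
    (by rw [hxy]; simp [mul_assoc])
  exact unop_injective (by simpa [mul_assoc] using this)

theorem RLevel.daProp {k : ℕ} {M : Type} [Monoid M] [Finite M] (h : RLevel k M) : DAProp M := by
  induction k generalizing M with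
  | zero =>
    have hJ : IsJTrivial M := h
    intro e he x a y hxy
    have h1 : e * x * (a * y) = e := by
      rw [mul_assoc, ← mul_assoc x, ← hxy]
      exact he
    have h2 : e * x = e := hJ.idem_mul_eq h1
    rw [h2, ← mul_assoc] at h1
    rw [hJ.idem_mul_eq h1]
    exact he
  | succ k ih =>
    have h1 : DAProp ((KCon M).Quotient)ᵐᵒᵖᵐᵒᵖ := (ih (M := ((KCon M).Quotient)ᵐᵒᵖ) h).op
    intro e he x a y hxy
    have h2 := h1 (MulOpposite.op (MulOpposite.op ((KCon M).mk' e)))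
      (by rw [IsIdempotentElem, ← op_mul, ← op_mul, ← map_mul, he.eq])
      (MulOpposite.op (MulOpposite.op ((KCon M).mk' x)))
      (MulOpposite.op (MulOpposite.op ((KCon M).mk' a)))
      (MulOpposite.op (MulOpposite.op ((KCon M).mk' y)))
      (by simp only [← op_mul, ← map_mul, ← hxy])
    simp only [← op_mul, ← map_mul] at h2
    have h3 : KRel (e * a * e) e :=
      kCon_iff_kRel.1 ((Con.eq _).1 (op_injective (op_injective h2)))
    have h4 := h3 e (Or.inr ⟨1, by rw [mul_one, he.eq]⟩)
    rwa [← mul_assoc, ← mul_assoc, he.eq] at h4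

section DA

variable {M : Type} [Monoid M] [Finite M]

theorem DAProp.rStable_factor (h : DAProp M) {P x a y : M} (hP : RStable P (x * a * y)) :
    RStable P a := by
  obtain ⟨z, hz⟩ := hP
  obtain ⟨n, hn⟩ := exists_isIdempotentElem_pow (x * a * y * z)
  have h1 : P * (x * a * y * z) ^ (n + 1) = P := by
    have := mul_pow_mul_eq_self (x := P) (s := 1) (t := x * a * y * z)
      (by simpa [mul_assoc] using hz) (n + 1)
    simpa using this
  have h2 := h _ hn ((x * a * y * z) ^ n * x) a (y * z) (by rw [pow_succ]; simp only [mul_assoc])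
  refine ⟨(x * a * y * z) ^ (n + 1), ?_⟩
  calc P * a * (x * a * y * z) ^ (n + 1)
      = P * (x * a * y * z) ^ (n + 1) * a * (x * a * y * z) ^ (n + 1) := by rw [h1]
    _ = P * ((x * a * y * z) ^ (n + 1) * a * (x * a * y * z) ^ (n + 1)) := by
      simp only [mul_assoc]
    _ = P := by rw [h2, h1]

theorem DAProp.rStable_mul_iff (h : DAProp M) {P a b : M} :
    RStable P (a * b) ↔ RStable P a ∧ RStable P b := by
  constructor
  · intro hP
    exact ⟨h.rStable_factor (x := 1) (y := b) (by simpa using hP),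
      h.rStable_factor (x := a) (y := 1) (by simpa using hP)⟩
  · rintro ⟨⟨z, hz⟩, ⟨t, ht⟩⟩
    obtain ⟨n, hn⟩ := exists_isIdempotentElem_pow (a * z * (b * t))
    set g := (a * z * (b * t)) ^ (n + 1) with hg
    have hg' : g = (a * z * (b * t)) ^ n * (a * z * (b * t)) := by rw [hg, pow_succ]
    have h1 : P * g = P := by
      have := mul_pow_mul_eq_self (x := P) (s := 1) (t := a * z * (b * t))
        (by rw [one_mul, ← mul_assoc, ← mul_assoc P, hz, ← mul_assoc, ht]) (n + 1)
      simpa using this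
    have ha : g * a * g = g := h g hn ((a * z * (b * t)) ^ n) a (z * (b * t)) (by
      rw [hg']; simp only [mul_assoc])
    have hb : g * b * g = g := h g hn ((a * z * (b * t)) ^ n * (a * z)) b t (by
      rw [hg']; simp only [mul_assoc])
    have hid : IsIdempotentElem (g * a) := by rw [IsIdempotentElem, ← mul_assoc, ha]
    have hh : g * a * b * (g * a) = g * a := h (g * a) hid g b (g * a) (by
      rw [← mul_assoc, hb])
    have hab : g * a * b * g = g := by
      calc g * a * b * g = g * a * b * (g * a * g) := by rw [ha]
        _ = g * a * b * (g * a) * g := by simp only [mul_assoc]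
        _ = g := by rw [hh, ha]
    refine ⟨g, ?_⟩
    calc P * (a * b) * g = P * g * (a * b) * g := by rw [h1]
      _ = P * (g * a * b * g) := by simp only [mul_assoc]
      _ = P := by rw [hab, h1]

theorem DAProp.lStable_mul_iff (h : DAProp M) {Q a b : M} :
    LStable Q (a * b) ↔ LStable Q a ∧ LStable Q b := by
  rw [lStable_iff, lStable_iff, lStable_iff, op_mul, h.op.rStable_mul_iff, and_comm]

end DA

end FiniteMonoids

section Soundness

open MulOpposite

variable {A : Type}

theorem MDivides.of_kernel {T M N : Type} [Monoid T] [Monoid M] [Monoid N] (f : T →* M)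
    (g : T →* N) (hf : Function.Surjective f) (hfg : ∀ x y, g x = g y → f x = f y) :
    MDivides M N := by
  refine ⟨MonoidHom.mrange g, (Con.lift (Con.ker g) f fun x y h => hfg x y h).comp
    (Con.quotientKerEquivRange g).symm.toMonoidHom, fun y => ?_⟩
  obtain ⟨t, rfl⟩ := hf y
  refine ⟨Con.quotientKerEquivRange g (Con.toQuotient t), ?_⟩
  simp only [MonoidHom.comp_apply, MulEquiv.coe_toMonoidHom, MulEquiv.symm_apply_apply]
  rfl

theorem MDivides.of_con {T M N : Type} [Monoid T] [Monoid M] [Monoid N] {C : Con T}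
    (h : MDivides M C.Quotient) (g : T →* N) (hg : ∀ x y, g x = g y → C x y) :
    MDivides M N := by
  obtain ⟨S, f, hf⟩ := h
  refine MDivides.of_kernel (T := S.comap C.mk') (f.comp (C.mk'.submonoidComap S))
    (g.comp (S.comap C.mk').subtype)
    (hf.comp (MonoidHom.submonoidComap_surjective_of_surjective _ _ Con.mk'_surjective))
    fun x y h => congrArg f (Subtype.ext ?_)
  exact (Con.eq _).2 (hg _ _ h)

theorem MDivides.rLevel {M N : Type} [Monoid M] [Monoid N] [Finite N] (h : MDivides M N) {k : ℕ}
    (hN : RLevel k N) : RLevel k M := by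
  obtain ⟨S, f, hf⟩ := h
  exact hN.of_kernel f S.subtype hf fun x y h => congrArg f (Subtype.ext h)

theorem MDivides.rLevel_op {M N : Type} [Monoid M] [Monoid N] [Finite N] (h : MDivides M N)
    {k : ℕ} (hN : RLevel k Nᵐᵒᵖ) : RLevel k Mᵐᵒᵖ := by
  obtain ⟨S, f, hf⟩ := h
  refine hN.of_kernel (MonoidHom.op f) (MonoidHom.op S.subtype) (fun y => ?_) fun x y h => ?_
  · obtain ⟨x, hx⟩ := hf (unop y)
    exact ⟨op x, unop_injective hx⟩
  · exact congrArg op (congrArg f (Subtype.ext (op_injective h)))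

/-- The relation `≡_{m,n}^X` as a congruence on the free monoid. -/
def xCon (A : Type) (n m : ℕ) : Con (FreeMonoid A) where
  r u v := ListX n m u.toList v.toList
  iseqv := ⟨fun _ => ListX.refl _ _ _, fun h => h.symm, fun h h' => h.trans h'⟩
  mul' h h' := by
    simpa only [FreeMonoid.toList_mul] using h.append h'

theorem xCon_iff {n m : ℕ} {u v : FreeMonoid A} :
    xCon A n m u v ↔ ListX n m u.toList v.toList := Iff.rfl

instance finite_xCon_quotient [Finite A] (n m : ℕ) : Finite (xCon A n m).Quotient := by
  obtain ⟨F, _, c, hc⟩ := ListX.exists_finite_invariant (A := A) n m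
  refine Finite.of_injective (fun q : (xCon A n m).Quotient => c (Quotient.out q).toList) ?_
  intro q q' h
  rw [← Quotient.out_eq q, ← Quotient.out_eq q']
  exact Quotient.sound (hc _ _ h)

/-- Reversal of words, as a homomorphism to the opposite monoid. -/
def wordReverse (A : Type) : FreeMonoid A →* (FreeMonoid A)ᵐᵒᵖ where
  toFun u := op (FreeMonoid.ofList u.toList.reverse)
  map_one' := rfl
  map_mul' u v := by
    simp [FreeMonoid.toList_mul, ← op_mul, ← FreeMonoid.ofList_append]

theorem ListX.append_flatten_replicate {n m : ℕ} {p w : List A} (h : ListX n m (p ++ w) p)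
    (j : ℕ) : ListX n m (p ++ (List.replicate j w).flatten) p := by
  induction j with
  | zero => simpa using ListX.refl n m p
  | succ j ih =>
    rw [List.replicate_succ, List.flatten_cons, ← List.append_assoc]
    exact (h.append (ListX.refl _ _ _)).trans ih

theorem rLevel_xCon_quotient [Finite A] (n k : ℕ) : RLevel k (xCon A n (k + 1)).Quotient := by
  induction k with
  | zero =>
    refine isJTrivial_of_mul fun x y a b c d h1 h2 => ?_
    induction x using Con.induction_on with | H x =>
    induction y using Con.induction_on with | H y =>
    induction a using Con.induction_on with | H a =>
    induction b using Con.induction_on with | H b =>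
    induction c using Con.induction_on with | H c =>
    induction d using Con.induction_on with | H d =>
    simp only [← Con.coe_mul] at h1 h2
    rw [Con.eq, xCon_iff, listX_one_iff] at h1 h2 ⊢
    simp only [FreeMonoid.toList_mul] at h1 h2
    intro w hw
    constructor
    · intro h
      refine (h1 w hw).1 (h.trans ?_)
      rw [List.append_assoc]
      exact (List.sublist_append_left _ _).trans (List.sublist_append_right _ _)
    · intro h
      refine (h2 w hw).1 (h.trans ?_)
      rw [List.append_assoc]
      exact (List.sublist_append_left _ _).trans (List.sublist_append_right _ _)
  | succ k ih =>
    let Q := (xCon A n (k + 2)).Quotient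
    let F : FreeMonoid A →* (KCon Q).Quotient := (KCon Q).mk'.comp (xCon A n (k + 2)).mk'
    refine RLevel.of_kernel (k := k) ((MonoidHom.op F).comp (wordReverse A))
      (xCon A n (k + 1)).mk' ?_ ?_ ih
    · intro y
      induction y using MulOpposite.rec' with
      | h y =>
        obtain ⟨y, rfl⟩ := Con.mk'_surjective y
        obtain ⟨x, rfl⟩ := Con.mk'_surjective y
        exact ⟨FreeMonoid.ofList x.toList.reverse,
          congrArg (fun l => op (F (FreeMonoid.ofList l))) (List.reverse_reverse x.toList)⟩
    · intro u v huv
      have h1 : ListX n (k + 1) u.toList v.toList := (Con.eq _).1 huv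
      refine congrArg op ((Con.eq _).2 (kCon_of_kRel ?_))
      have key : ∀ {u v : List A}, ListX n (k + 1) u v → ∀ P : Q,
          RStable P ((xCon A n (k + 2)).mk' (FreeMonoid.ofList u.reverse)) →
          P * (xCon A n (k + 2)).mk' (FreeMonoid.ofList u.reverse) =
            P * (xCon A n (k + 2)).mk' (FreeMonoid.ofList v.reverse) := by
        rintro u v huv P ⟨z, hz⟩
        obtain ⟨p, rfl⟩ := Con.mk'_surjective P
        obtain ⟨z, rfl⟩ := Con.mk'_surjective z
        have h2 : ListX n (k + 2) (p.toList ++ (u.reverse ++ z.toList)) p.toList := by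
          have := (Con.eq _).1 hz
          simpa [xCon_iff, FreeMonoid.toList_mul] using this
        have goal : ListX n (k + 2) (p.toList ++ u.reverse) (p.toList ++ v.reverse) := by
          cases n with
          | zero => exact ListX.zero_left _ _ _
          | succ n =>
            have hal : ∀ a, a ∈ u ↔ a ∈ v := huv.1
            have h3 := ListX.absorb (n := n + 1) (m := k + 1)
              (B := {a | a ∈ u.reverse ++ z.toList})
              (L := List.replicate (n + 1) (u.reverse ++ z.toList)) (u := u.reverse)
              (v := v.reverse) p.toList (by simp)
              (fun l hl a => by rw [List.eq_of_mem_replicate hl]; rfl)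
              (fun a ha => List.mem_append_left _ ha)
              (fun a ha => List.mem_append_left _ (by simpa [hal] using ha))
              (by simpa using huv)
            have h4 := h2.append_flatten_replicate (n + 1)
            exact ((h4.symm.append (ListX.refl _ _ _)).trans h3).trans
              (h4.append (ListX.refl _ _ _))
        exact (Con.eq _).2 (by simpa [xCon_iff, FreeMonoid.toList_mul] using goal)
      rintro P (hP | hP)
      · exact key h1 P hP
      · exact (key h1.symm P hP).symm

/-- The homomorphism whose kernel is `≡_{m,n}^Y`. -/
def yHom (A : Type) (n m : ℕ) : FreeMonoid A →* ((xCon A n m).Quotient)ᵐᵒᵖ :=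
  (MonoidHom.op (xCon A n m).mk').comp (wordReverse A)

theorem listX_reverse_of_yHom_eq {n m : ℕ} {u v : FreeMonoid A}
    (h : yHom A n m u = yHom A n m v) : ListX n m u.toList.reverse v.toList.reverse :=
  (Con.eq _).1 (op_injective h)

theorem rLevel_op_op_xCon_quotient [Finite A] (n k : ℕ) :
    RLevel k ((xCon A n (k + 1)).Quotient)ᵐᵒᵖᵐᵒᵖ :=
  (rLevel_xCon_quotient n k).of_mulEquiv (MulEquiv.opOp _)

variable {M : Type} [Monoid M]

theorem rLevel_of_mDivides [Finite A] {C : Con (FreeMonoid A)} {n k : ℕ}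
    (hC : ∀ u v : FreeMonoid A, ListX n (k + 1) u.toList v.toList → C u v)
    (h : MDivides M C.Quotient) : RLevel k M :=
  (h.of_con (xCon A n (k + 1)).mk' fun u v huv => hC u v ((Con.eq _).1 huv)).rLevel
    (rLevel_xCon_quotient n k)

theorem rLevel_op_of_mDivides [Finite A] {C : Con (FreeMonoid A)} {n k : ℕ}
    (hC : ∀ u v : FreeMonoid A, ListX n (k + 1) u.toList.reverse v.toList.reverse → C u v)
    (h : MDivides M C.Quotient) : RLevel k Mᵐᵒᵖ :=
  (h.of_con (yHom A n (k + 1)) fun u v huv => hC u v (listX_reverse_of_yHom_eq huv)).rLevel_op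
    (rLevel_op_op_xCon_quotient n k)

theorem inJoin_of_mDivides [Finite A] {C : Con (FreeMonoid A)} {n k : ℕ}
    (hC : ∀ u v : FreeMonoid A, ListX n (k + 1) u.toList v.toList →
      ListX n (k + 1) u.toList.reverse v.toList.reverse → C u v)
    (h : MDivides M C.Quotient) : InJoin (k + 1) M := by
  refine ⟨(xCon A n (k + 1)).Quotient, ((xCon A n (k + 1)).Quotient)ᵐᵒᵖ, inferInstance,
    inferInstance, inferInstance, inferInstance, inRLAux_iff.1.2 (rLevel_xCon_quotient n k),
    inRLAux_iff.2.2 (rLevel_op_op_xCon_quotient n k), ?_⟩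
  refine h.of_con ((xCon A n (k + 1)).mk'.prod (yHom A n (k + 1))) fun u v huv => ?_
  exact hC u v ((Con.eq _).1 (congrArg Prod.fst huv))
    (listX_reverse_of_yHom_eq (congrArg Prod.snd huv))

end Soundness

section Completeness

open MulOpposite

variable {A M : Type} [Monoid M]

/-- The value of a word under an assignment of the letters. -/
def wordVal (f : A → M) (l : List A) : M := (l.map f).prod

@[simp] theorem wordVal_nil (f : A → M) : wordVal f [] = 1 := rfl

@[simp] theorem wordVal_cons (f : A → M) (a : A) (l : List A) :
    wordVal f (a :: l) = f a * wordVal f l := by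
  simp [wordVal]

@[simp] theorem wordVal_append (f : A → M) (l k : List A) :
    wordVal f (l ++ k) = wordVal f l * wordVal f k := by
  simp [wordVal]

theorem map_wordVal {N : Type} [Monoid N] (φ : M →* N) (f : A → M) (l : List A) :
    φ (wordVal f l) = wordVal (fun a => φ (f a)) l := by
  induction l with
  | nil => simp
  | cons a l ih => simp [ih]

theorem op_wordVal_reverse (f : A → M) (l : List A) :
    op (wordVal f l.reverse) = wordVal (fun a => op (f a)) l := by
  induction l with
  | nil => simp
  | cons a l ih => simp [ih]

theorem DAProp.rStable_wordVal_iff [Finite M] (h : DAProp M) {P : M} {f : A → M} {l : List A} :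
    RStable P (wordVal f l) ↔ ∀ a ∈ l, RStable P (f a) := by
  induction l with
  | nil => simp [RStable.one]
  | cons a l ih => simp [h.rStable_mul_iff, ih]

theorem DAProp.lStable_wordVal_iff [Finite M] (h : DAProp M) {Q : M} {f : A → M} {l : List A} :
    LStable Q (wordVal f l) ↔ ∀ a ∈ l, LStable Q (f a) := by
  induction l with
  | nil => simpa using ⟨1, by simp⟩
  | cons a l ih => simp [h.lStable_mul_iff, ih]

theorem RStable.of_mul {P x y : M} (h : RStable P (x * y)) : RStable (P * x) y := by
  obtain ⟨z, hz⟩ := h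
  exact ⟨z * x, by simpa only [mul_assoc] using congrArg (· * x) hz⟩

theorem LStable.of_mul {Q x y : M} (h : LStable Q (x * y)) : LStable (y * Q) x := by
  obtain ⟨z, hz⟩ := h
  exact ⟨y * z, by simpa only [mul_assoc] using congrArg (y * ·) hz⟩

/-- The size of the right ideal generated by `P`. -/
noncomputable def rHeight (P : M) : ℕ := (Set.range (fun z => P * z)).ncard

/-- The size of the left ideal generated by `Q`. -/
noncomputable def lHeight (Q : M) : ℕ := (Set.range (fun z => z * Q)).ncard

theorem rHeight_mul_lt [Finite M] {P x : M} (h : ¬ RStable P x) : rHeight (P * x) < rHeight P := by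
  refine Set.ncard_lt_ncard ⟨?_, fun hs => h ?_⟩ (Set.toFinite _)
  · rintro _ ⟨z, rfl⟩
    exact ⟨x * z, by simp [mul_assoc]⟩
  · obtain ⟨z, hz⟩ := hs ⟨1, rfl⟩
    exact ⟨z, by simpa using hz⟩

theorem lHeight_mul_lt [Finite M] {Q x : M} (h : ¬ LStable Q x) : lHeight (x * Q) < lHeight Q := by
  refine Set.ncard_lt_ncard ⟨?_, fun hs => h ?_⟩ (Set.toFinite _)
  · rintro _ ⟨z, rfl⟩
    exact ⟨z * x, by simp [mul_assoc]⟩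
  · obtain ⟨z, hz⟩ := hs ⟨1, rfl⟩
    exact ⟨z, by simpa using hz⟩

theorem rHeight_pos [Finite M] (P : M) : 0 < rHeight P :=
  (Set.ncard_pos (Set.toFinite _)).2 ⟨P * 1, 1, rfl⟩

theorem lHeight_pos [Finite M] (Q : M) : 0 < lHeight Q :=
  (Set.ncard_pos (Set.toFinite _)).2 ⟨1 * Q, 1, rfl⟩

theorem exists_first_failure (p : A → Prop) (u : List A) (h : ¬ ∀ a ∈ u, p a) :
    ∃ s a r, u = s ++ a :: r ∧ (∀ b ∈ s, p b) ∧ ¬ p a := by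
  induction u with
  | nil => simp at h
  | cons a u ih =>
    by_cases ha : p a
    · obtain ⟨s, b, r, rfl, hs, hb⟩ := ih fun hu => h (by simpa [ha] using hu)
      exact ⟨a :: s, b, r, rfl, by simpa [ha] using hs, hb⟩
    · exact ⟨[], a, u, rfl, by simp, ha⟩

theorem exists_last_failure (p : A → Prop) (u : List A) (h : ¬ ∀ a ∈ u, p a) :
    ∃ s a r, u = s ++ a :: r ∧ (∀ b ∈ r, p b) ∧ ¬ p a := by
  obtain ⟨s, a, r, hu, hs, ha⟩ := exists_first_failure p u.reverse (by simpa using h)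
  exact ⟨r.reverse, a, s.reverse, by simpa using congrArg List.reverse hu, by simpa using hs, ha⟩

/-- The inductive step of completeness for `≡^WI`: if the level-`m` relation controls the factors
which stay in the `R`-class of a left context and in the `L`-class of a right context, then the level-`m + 1`
relation controls all words. -/
theorem wordVal_eq_of_listW [Finite M] (hDA : DAProp M) (f : A → M) {n₀ m : ℕ}
    (H : ∀ w w', ListW n₀ m w w' → ∀ P Q, RStable P (wordVal f w) → LStable Q (wordVal f w') →
      P * wordVal f w * Q = P * wordVal f w' * Q) (N : ℕ) :
    (∀ P Q u v, rHeight P + lHeight Q + n₀ < N → ListW N (m + 1) u v →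
      P * wordVal f u * Q = P * wordVal f v * Q) ∧
    (∀ P Q s a r s' r', rHeight P + lHeight Q + n₀ < N →
      ListW N (m + 1) (s ++ a :: r) (s' ++ a :: r') → a ∉ s → a ∉ s' →
      RStable P (wordVal f s) →
      P * wordVal f s * (f a * wordVal f r' * Q) =
        P * wordVal f s' * (f a * wordVal f r' * Q)) := by
  induction N with
  | zero => exact ⟨fun _ _ _ _ h => absurd h (by omega), fun _ _ _ _ _ _ _ h => absurd h (by omega)⟩
  | succ N ih =>
    obtain ⟨ih1, ih2⟩ := ih
    have C2 : ∀ P Q s a r s' r', rHeight P + lHeight Q + n₀ < N + 1 →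
        ListW (N + 1) (m + 1) (s ++ a :: r) (s' ++ a :: r') → a ∉ s → a ∉ s' →
        RStable P (wordVal f s) →
        P * wordVal f s * (f a * wordVal f r' * Q) =
          P * wordVal f s' * (f a * wordVal f r' * Q) := by
      intro P Q s a r s' r' hN h has has' hP
      have hposP := rHeight_pos P
      have hposQ := lHeight_pos Q
      obtain ⟨hal, hfirst, hlast, hC, hCab⟩ := h
      obtain ⟨hs, hr⟩ := hfirst a s r s' r' rfl has rfl has'
      have hralph : ∀ b, b ∈ r ↔ b ∈ r' := by
        obtain ⟨N, rfl⟩ := Nat.exists_eq_succ_of_ne_zero (show N ≠ 0 by omega)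
        exact hr.1
      by_cases hv : ∀ b ∈ s' ++ a :: r', LStable Q (f b)
      · have h1 : LStable Q (wordVal f s' * wordVal f (a :: r')) := by
          rw [← wordVal_append]
          exact hDA.lStable_wordVal_iff.2 hv
        have h2 := H s s' (hs.mono (by omega) le_rfl) P _ hP h1.of_mul
        simpa using h2
      · obtain ⟨v', b, t, hvt, ht, hb⟩ := exists_last_failure _ _ hv
        have hbt : b ∉ t := fun hbt => hb (ht b hbt)
        have hQ2 : lHeight (f b * wordVal f t * Q) < lHeight Q :=
          lHeight_mul_lt fun hQ => hb (hDA.lStable_mul_iff.1 hQ).1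
        by_cases hbr' : b ∈ r'
        · obtain ⟨r₁', t', rfl, hbt'⟩ := exists_last_split hbr'
          obtain ⟨r₁, w, rfl, hbw⟩ := exists_last_split ((hralph b).2 hbr')
          obtain ⟨rfl, rfl⟩ := last_split_unique (s := s' ++ a :: r₁') (s' := v')
            (by rw [← hvt]; simp) hbt' hbt
          have h1 := (hlast b (s ++ a :: r₁) w (s' ++ a :: r₁') t' (by simp) hbw (by simp) hbt').1
          have h2 := ih2 P (f b * wordVal f t' * Q) s a r₁ s' r₁' (by omega) h1 has has' hP
          simpa [mul_assoc] using h2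
        · have hbr : b ∉ r := fun hbr => hbr' ((hralph b).1 hbr)
          by_cases hab : b = a
          · subst hab
            obtain ⟨rfl, rfl⟩ := last_split_unique hvt hbr' hbt
            have h1 := (hlast b s r s' r' rfl hbr rfl hbr').1
            exact ih1 P (f b * wordVal f r' * Q) s s' (by omega) h1
          · have hbs' : b ∈ s' := by
              have : b ∈ s' ++ a :: r' := by simp [hvt]
              simpa [hab, hbr'] using this
            have hbs : b ∈ s := by
              have : b ∈ s ++ a :: r := (hal b).2 (by simp [hbs'])
              simpa [hab, hbr] using this
            obtain ⟨s₁', t', rfl, hbt'⟩ := exists_last_split hbs'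
            obtain ⟨s₁, t₁, rfl, hbt₁⟩ := exists_last_split hbs
            have hb1 : b ∉ t₁ ++ a :: r := by simp [hbt₁, hab, hbr]
            have hb2 : b ∉ t' ++ a :: r' := by simp [hbt', hab, hbr']
            obtain ⟨rfl, rfl⟩ := last_split_unique (s := s₁') (r := t' ++ a :: r')
              (by rw [← hvt]; simp) hb2 hbt
            have h1 := (hlast b s₁ (t₁ ++ a :: r) s₁' (t' ++ a :: r') (by simp) hb1 (by simp)
              hb2).1
            have h2 := hCab a b s₁ t₁ r s₁' t' r' (by simp) has hb1 (by simp) has' hb2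
            have hP' : RStable (P * (wordVal f s₁ * f b)) (wordVal f t₁) := by
              refine RStable.of_mul ?_
              simpa [mul_assoc] using hP
            have hQ' : LStable (wordVal f (a :: r') * Q) (wordVal f t') := by
              refine LStable.of_mul ?_
              rw [← wordVal_append]
              exact hDA.lStable_wordVal_iff.2 ht
            have h3 := H t₁ t' (h2.mono (by omega) le_rfl) _ _ hP' hQ'
            have h4 := ih1 P (f b * wordVal f (t' ++ a :: r') * Q) s₁ s₁' (by omega) h1
            simp only [wordVal_append, wordVal_cons, mul_assoc] at h3 h4 ⊢
            rw [h3, h4]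
    refine ⟨fun P Q u v hN h => ?_, C2⟩
    by_cases hu : ∀ b ∈ u, RStable P (f b)
    · have hPu : RStable P (wordVal f u) := hDA.rStable_wordVal_iff.2 hu
      by_cases hv : ∀ b ∈ v, LStable Q (f b)
      · exact H u v (h.mono (by omega) (by omega)) P Q hPu (hDA.lStable_wordVal_iff.2 hv)
      · obtain ⟨v', b, t', rfl, ht', hb⟩ := exists_last_failure _ _ hv
        have hbt' : b ∉ t' := fun hbt => hb (ht' b hbt)
        obtain ⟨hal, -, hlast, -, -⟩ := h
        obtain ⟨u', t, rfl, hbt⟩ := exists_last_split ((hal b).2 (by simp))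
        obtain ⟨h1, h2⟩ := hlast b u' t v' t' rfl hbt rfl hbt'
        have hQ2 : lHeight (f b * wordVal f t' * Q) < lHeight Q :=
          lHeight_mul_lt fun hQ => hb (hDA.lStable_mul_iff.1 hQ).1
        have hP' : RStable (P * (wordVal f u' * f b)) (wordVal f t) := by
          refine RStable.of_mul ?_
          simpa [mul_assoc] using hPu
        have h3 := H t t' (h2.mono (by omega) le_rfl) _ Q hP' (hDA.lStable_wordVal_iff.2 ht')
        have h4 := ih1 P (f b * wordVal f t' * Q) u' v' (by omega) h1
        simp only [wordVal_append, wordVal_cons, mul_assoc] at h3 h4 ⊢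
        rw [h3, h4]
    · obtain ⟨s, a, r, rfl, hs, ha⟩ := exists_first_failure _ _ hu
      have has : a ∉ s := fun h => ha (hs a h)
      obtain ⟨s', r', rfl, has'⟩ := exists_first_split ((h.1 a).1 (by simp))
      have h1 := C2 P Q s a r s' r' hN h has has' (hDA.rStable_wordVal_iff.2 hs)
      have hP' : rHeight (P * (wordVal f s * f a)) < rHeight P :=
        rHeight_mul_lt fun hP => ha (hDA.rStable_mul_iff.1 hP).2
      have h2 := ih1 (P * (wordVal f s * f a)) Q r r' (by omega)
        (h.2.1 a s r s' r' rfl has rfl has').2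
      simp only [wordVal_append, wordVal_cons, mul_assoc] at h1 h2 ⊢
      rw [h2, h1]

theorem exists_listW_bound [Finite M] (hDA : DAProp M) (f : A → M) {n₀ m : ℕ}
    (H : ∀ w w', ListW n₀ m w w' → ∀ P Q, RStable P (wordVal f w) → LStable Q (wordVal f w') →
      P * wordVal f w * Q = P * wordVal f w' * Q) :
    ∃ n, ∀ u v, ListW n (m + 1) u v → wordVal f u = wordVal f v := by
  refine ⟨rHeight (1 : M) + lHeight (1 : M) + n₀ + 1, fun u v h => ?_⟩
  simpa using (wordVal_eq_of_listW hDA f H _).1 1 1 u v (by omega) h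

theorem exists_listW_bound_of_stable [Finite M] (hDA : DAProp M) (f : A → M)
    (hR : ∀ P x : M, RStable P x → P * x = P) (hL : ∀ Q x : M, LStable Q x → x * Q = Q) :
    ∃ n, ∀ u v, ListW n 1 u v → wordVal f u = wordVal f v := by
  refine exists_listW_bound (n₀ := 0) (m := 0) hDA f fun w w' _ P Q hP hQ => ?_
  rw [hR P _ hP, mul_assoc, hL Q _ hQ]

theorem exists_listX_bound [Finite M] {k : ℕ} (hM : RLevel k M) (f : A → M) :
    ∃ n, ∀ u v, ListX n (k + 1) u v → wordVal f u = wordVal f v := by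
  induction k generalizing M with
  | zero =>
    have hJ : IsJTrivial M := hM
    obtain ⟨n, hn⟩ := exists_listW_bound_of_stable hM.daProp f
      (fun P x ⟨_, hz⟩ => hJ.idem_mul_eq hz) (fun Q x ⟨_, hz⟩ => hJ.mul_idem_eq hz)
    exact ⟨n + 1, fun u v h => hn u v (listX_one_iff.1 h).listW⟩
  | succ k ih =>
    have hDA := hM.daProp
    obtain ⟨n₀, hn₀⟩ := ih (M := ((KCon M).Quotient)ᵐᵒᵖ) hM fun a => op ((KCon M).mk' (f a))
    have hK : ∀ u v, ListX n₀ (k + 1) u.reverse v.reverse → KRel (wordVal f u) (wordVal f v) := by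
      intro u v h
      have h1 := hn₀ _ _ h
      rw [← op_wordVal_reverse (fun a => (KCon M).mk' (f a)),
        ← op_wordVal_reverse (fun a => (KCon M).mk' (f a)), ← map_wordVal, ← map_wordVal] at h1
      simpa using kCon_iff_kRel.1 ((Con.eq _).1 (op_injective h1))
    have key : ∀ N P u v, rHeight P + n₀ < N → ListX N (k + 2) u v →
        P * wordVal f u = P * wordVal f v := by
      intro N
      induction N with
      | zero => exact fun _ _ _ h => absurd h (by omega)
      | succ N ihN =>
        rintro P u v hN ⟨hal, hrev, hsplit⟩
        by_cases hu : ∀ b ∈ u, RStable P (f b)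
        · exact hK u v (hrev.mono (by omega) le_rfl) P
            (Or.inl (hDA.rStable_wordVal_iff.2 hu))
        · obtain ⟨s, a, r, rfl, hs, ha⟩ := exists_first_failure _ _ hu
          have has : a ∉ s := fun h => ha (hs a h)
          obtain ⟨s', r', rfl, has'⟩ := exists_first_split ((hal a).1 (by simp))
          obtain ⟨h1, h2⟩ := hsplit a s r s' r' rfl has rfl has'
          have hP' : rHeight (P * (wordVal f s * f a)) < rHeight P :=
            rHeight_mul_lt fun hP => ha (hDA.rStable_mul_iff.1 hP).2
          have h3 := ihN (P * (wordVal f s * f a)) r r' (by omega) h2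
          have h4 := hK s s' (h1.mono (by omega) le_rfl) P
            (Or.inl (hDA.rStable_wordVal_iff.2 hs))
          simp only [wordVal_append, wordVal_cons, ← mul_assoc] at h3 h4 ⊢
          rw [h3, h4]
    exact ⟨rHeight (1 : M) + n₀ + 1, fun u v h => by
      simpa using key _ 1 u v (by omega) h⟩

theorem RLevel.mul_eq_of_rStable [Finite M] (hM : RLevel 1 M) {P x : M} (hP : RStable P x) :
    P * x = P := by
  obtain ⟨z, hz⟩ := hP
  have hJ : IsJTrivial ((KCon M).Quotient)ᵐᵒᵖ := hM
  obtain ⟨n, hn⟩ := exists_isIdempotentElem_pow (x * z)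
  have h1 : (x * z) ^ (n + 1) * x * (z * (x * z) ^ n) = (x * z) ^ (n + 1) := by
    rw [mul_assoc, ← mul_assoc x, ← pow_succ']
    exact hn
  have h2 := hJ.mul_idem_eq (e := op ((KCon M).mk' ((x * z) ^ (n + 1))))
    (x := op ((KCon M).mk' x)) (y := op ((KCon M).mk' (z * (x * z) ^ n))) (by
      rw [← op_mul, ← op_mul, ← map_mul, ← map_mul, h1])
  rw [← op_mul, ← map_mul] at h2
  have h3 : KRel _ _ := kCon_iff_kRel.1 ((Con.eq _).1 (op_injective h2))
  have h4 : P * (x * z) ^ (n + 1) = P := by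
    simpa using mul_pow_mul_eq_self (x := P) (s := 1) (t := x * z)
      (by simpa [mul_assoc] using hz) (n + 1)
  have h5 := h3 P (Or.inr ⟨1, by rw [mul_one, h4]⟩)
  rwa [← mul_assoc, h4] at h5

theorem RLevel.mul_eq_of_lStable [Finite M] (hM : RLevel 1 Mᵐᵒᵖ) {Q x : M} (hQ : LStable Q x) :
    x * Q = Q :=
  op_injective (hM.mul_eq_of_rStable (lStable_iff.1 hQ))

/-- Two elements are related if they stay in the same `R`-classes and `L`-classes and act in the
same way between any such `R`-class and `L`-class. -/
def stableCon [Finite M] (h : DAProp M) : Con M where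
  r x y := (∀ P, RStable P x ↔ RStable P y) ∧ (∀ Q, LStable Q x ↔ LStable Q y) ∧
    ∀ P Q, RStable P x → LStable Q x → P * x * Q = P * y * Q
  iseqv := by
    refine ⟨fun x => ⟨fun _ => Iff.rfl, fun _ => Iff.rfl, fun _ _ _ _ => rfl⟩, ?_, ?_⟩
    · rintro x y ⟨h1, h2, h3⟩
      exact ⟨fun P => (h1 P).symm, fun Q => (h2 Q).symm,
        fun P Q hP hQ => (h3 P Q ((h1 P).2 hP) ((h2 Q).2 hQ)).symm⟩
    · rintro x y z ⟨h1, h2, h3⟩ ⟨k1, k2, k3⟩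
      exact ⟨fun P => (h1 P).trans (k1 P), fun Q => (h2 Q).trans (k2 Q),
        fun P Q hP hQ => (h3 P Q hP hQ).trans (k3 P Q ((h1 P).1 hP) ((h2 Q).1 hQ))⟩
  mul' := by
    rintro x y x' y' ⟨h1, h2, h3⟩ ⟨k1, k2, k3⟩
    refine ⟨fun P => ?_, fun Q => ?_, fun P Q hP hQ => ?_⟩
    · rw [h.rStable_mul_iff, h.rStable_mul_iff, h1, k1]
    · rw [h.lStable_mul_iff, h.lStable_mul_iff, h2, k2]
    · obtain ⟨hP1, hP2⟩ := h.rStable_mul_iff.1 hP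
      have e1 := h3 P (x' * Q) hP1 hQ.of_mul
      have e2 := k3 (P * y) Q (h.rStable_mul_iff.2 ⟨(h1 P).1 hP1, hP2⟩).of_mul
        (h.lStable_mul_iff.1 hQ).2
      simp only [mul_assoc] at e1 e2 ⊢
      rw [e1, e2]

theorem KRel.lStable [Finite M] (hDA : DAProp M) {x y Q : M} (h : KRel x y) (hQ : LStable Q x) :
    LStable Q y := by
  obtain ⟨z, hz⟩ := hQ
  obtain ⟨n, hn⟩ := exists_isIdempotentElem_pow (z * x)
  have h1 := hDA _ hn z x ((z * x) ^ n) (by rw [pow_succ'])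
  have h2 : (z * x) ^ (n + 1) * Q = Q := by
    simpa using mul_pow_mul_eq_self (x := Q) (s := z * x) (t := 1)
      (by simpa [mul_assoc] using hz) (n + 1)
  have h3 := h _ (Or.inl ⟨_, h1⟩)
  rw [h3] at h1
  refine ⟨(z * x) ^ (n + 1), ?_⟩
  calc (z * x) ^ (n + 1) * (y * Q)
      = (z * x) ^ (n + 1) * (y * ((z * x) ^ (n + 1) * Q)) := by rw [h2]
    _ = (z * x) ^ (n + 1) * y * (z * x) ^ (n + 1) * Q := by simp only [mul_assoc]
    _ = Q := by rw [h1, h2]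

theorem KRel.stableCon [Finite M] (hDA : DAProp M) {x y : M} (h : KRel x y) :
    stableCon hDA x y :=
  ⟨fun _ => ⟨fun hP => h.rStable hP, fun hP => h.symm.rStable hP⟩,
    fun _ => ⟨fun hQ => h.lStable hDA hQ, fun hQ => h.symm.lStable hDA hQ⟩,
    fun P Q hP _ => by rw [h P (Or.inl hP)]⟩

theorem lStable_op_iff {P x : M} : LStable (op P) (op x) ↔ RStable P x := by
  constructor
  · rintro ⟨z, hz⟩
    exact ⟨unop z, congrArg unop hz⟩
  · rintro ⟨z, hz⟩
    exact ⟨op z, unop_injective hz⟩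

theorem stableCon_of_op [Finite M] (hDA : DAProp M) {x y : M} (h : KRel (op x) (op y)) :
    stableCon hDA x y := by
  obtain ⟨h1, h2, -⟩ := h.stableCon hDA.op
  refine ⟨fun P => ?_, fun Q => ?_, fun P Q _ hQ => ?_⟩
  · rw [← lStable_op_iff, h2, lStable_op_iff]
  · rw [lStable_iff, h1, ← lStable_iff]
  · have : x * Q = y * Q := op_injective (h (op Q) (Or.inl (lStable_iff.1 hQ)))
    rw [mul_assoc, this, mul_assoc]

theorem exists_listW_bound_of_rLevel [Finite M] {k : ℕ} (hM : RLevel (k + 1) M)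
    (hM' : RLevel (k + 1) Mᵐᵒᵖ) (f : A → M) :
    ∃ n, ∀ u v, ListW n (k + 1) u v → wordVal f u = wordVal f v := by
  induction k generalizing M with
  | zero =>
    exact exists_listW_bound_of_stable hM.daProp f (fun P x h => hM.mul_eq_of_rStable h)
      (fun Q x h => hM'.mul_eq_of_lStable h)
  | succ k ih =>
    have hDA := hM.daProp
    have h1 : RLevel (k + 1) (stableCon hDA).Quotient := by
      refine RLevel.of_kernel (stableCon hDA).mk' ((MonoidHom.op (KCon Mᵐᵒᵖ).mk').comp
        (MulEquiv.opOp M).toMonoidHom) Con.mk'_surjective (fun x y h => ?_) hM'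
      exact (Con.eq _).2
        (stableCon_of_op hDA (kCon_iff_kRel.1 ((Con.eq _).1 (op_injective h))))
    have h2 : RLevel (k + 1) ((stableCon hDA).Quotient)ᵐᵒᵖ := by
      refine RLevel.of_kernel (MonoidHom.op (stableCon hDA).mk') (MonoidHom.op (KCon M).mk')
        (fun y => ?_) (fun x y h => ?_) hM
      · obtain ⟨x, hx⟩ := Con.mk'_surjective (unop y)
        exact ⟨op x, unop_injective hx⟩
      · exact congrArg op ((Con.eq _).2
          (KRel.stableCon hDA (kCon_iff_kRel.1 ((Con.eq _).1 (op_injective h)))))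
    obtain ⟨n₀, hn₀⟩ := ih h1 h2 fun a => (stableCon hDA).mk' (f a)
    refine exists_listW_bound (n₀ := n₀) hDA f fun w w' hw P Q hP hQ => ?_
    have h3 := hn₀ w w' hw
    rw [← map_wordVal, ← map_wordVal] at h3
    obtain ⟨-, h4, h5⟩ : stableCon hDA _ _ := (Con.eq _).1 h3
    exact h5 P Q hP ((h4 Q).2 hQ)

end Completeness

section Division

open MulOpposite

variable {M : Type} [Monoid M]

theorem wordVal_eq_lift {A : Type} (f : A → M) (u : FreeMonoid A) :
    FreeMonoid.lift f u = wordVal f u.toList :=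
  FreeMonoid.lift_apply f u

theorem mDivides_of_con_le {A : Type} {Z : ZKind} {m n : ℕ} (φ : FreeMonoid A →* M)
    (hφ : Function.Surjective φ)
    (h : ∀ u v : FreeMonoid A,
      wEquiv Z m n (GWord.ofList u.toList) (GWord.ofList v.toList) → φ u = φ v) :
    MDivides M (eqvCon A Z m n).Quotient := by
  have h1 : eqvCon A Z m n ≤ Con.ker φ := Con.conGen_le.2 h
  exact MDivides.of_kernel φ (eqvCon A Z m n).mk' hφ fun x y hxy => h1 ((Con.eq _).1 hxy)

theorem lift_id_surjective (M : Type) [Monoid M] :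
    Function.Surjective (FreeMonoid.lift (id : M → M)) :=
  fun x => ⟨FreeMonoid.of x, by simp⟩

theorem eqvCon_of_wEquiv {A : Type} {Z : ZKind} {m n : ℕ} {u v : FreeMonoid A}
    (h : wEquiv Z m n (GWord.ofList u.toList) (GWord.ofList v.toList)) : eqvCon A Z m n u v :=
  ConGen.Rel.of _ _ h

theorem rLevel_iff_mDivides [Finite M] {k : ℕ} : RLevel k M ↔
    ∃ (A : Type) (_ : Fintype A) (n : ℕ), MDivides M (eqvCon A ZKind.X (k + 1) n).Quotient := by
  constructor
  · intro h
    obtain ⟨n, hn⟩ := exists_listX_bound h id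
    refine ⟨M, Fintype.ofFinite M, n, mDivides_of_con_le _ (lift_id_surjective M) fun u v huv => ?_⟩
    rw [wordVal_eq_lift, wordVal_eq_lift]
    exact hn _ _ (wEquiv_X_iff.1 huv)
  · rintro ⟨A, _, n, h⟩
    exact rLevel_of_mDivides (fun u v huv => eqvCon_of_wEquiv (wEquiv_X_iff.2 huv)) h

theorem wordVal_reverse_bound [Finite M] {A : Type} {k : ℕ} (h : RLevel k Mᵐᵒᵖ) (f : A → M) :
    ∃ n, ∀ u v, ListX n (k + 1) u.reverse v.reverse → wordVal f u = wordVal f v := by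
  obtain ⟨n, hn⟩ := exists_listX_bound h fun a => op (f a)
  refine ⟨n, fun u v huv => ?_⟩
  have := hn _ _ huv
  rw [← op_wordVal_reverse, ← op_wordVal_reverse] at this
  simpa using op_injective this

theorem rLevel_op_iff_mDivides [Finite M] {k : ℕ} : RLevel k Mᵐᵒᵖ ↔
    ∃ (A : Type) (_ : Fintype A) (n : ℕ), MDivides M (eqvCon A ZKind.Y (k + 1) n).Quotient := by
  constructor
  · intro h
    obtain ⟨n, hn⟩ := wordVal_reverse_bound h id
    refine ⟨M, Fintype.ofFinite M, n, mDivides_of_con_le _ (lift_id_surjective M) fun u v huv => ?_⟩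
    rw [wordVal_eq_lift, wordVal_eq_lift]
    exact hn _ _ (wEquiv_Y_iff.1 huv)
  · rintro ⟨A, _, n, h⟩
    exact rLevel_op_of_mDivides (fun u v huv => eqvCon_of_wEquiv (wEquiv_Y_iff.2 huv)) h

theorem inJoin_iff_mDivides {k : ℕ} : InJoin (k + 1) M ↔
    ∃ (A : Type) (_ : Fintype A) (n : ℕ), MDivides M (eqvCon A ZKind.XY (k + 1) n).Quotient := by
  constructor
  · rintro ⟨M₁, M₂, i₁, i₂, _, _, h₁, h₂, S, φ, hφ⟩
    obtain ⟨n₁, hn₁⟩ := exists_listX_bound (inRLAux_iff.1.1 h₁) fun x : S => x.1.1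
    obtain ⟨n₂, hn₂⟩ := wordVal_reverse_bound (inRLAux_iff.2.1 h₂) fun x : S => x.1.2
    refine ⟨S, Fintype.ofFinite S, max n₁ n₂, mDivides_of_con_le
      (φ.comp (FreeMonoid.lift (id : S → S))) (hφ.comp (lift_id_surjective S)) fun u v huv => ?_⟩
    obtain ⟨h3, h4⟩ := wEquiv_XY_iff.1 huv
    have h5 := hn₁ _ _ (h3.mono (le_max_left _ _) le_rfl)
    have h6 := hn₂ _ _ (h4.mono (le_max_right _ _) le_rfl)
    refine congrArg φ (Subtype.ext (Prod.ext ?_ ?_))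
    · have h7 : ∀ l : List S, (wordVal id l).1.1 = wordVal (fun x : S => x.1.1) l :=
        fun l => map_wordVal ((MonoidHom.fst M₁ M₂).comp S.subtype) id l
      rw [wordVal_eq_lift, wordVal_eq_lift, h7, h7, h5]
    · have h7 : ∀ l : List S, (wordVal id l).1.2 = wordVal (fun x : S => x.1.2) l :=
        fun l => map_wordVal ((MonoidHom.snd M₁ M₂).comp S.subtype) id l
      rw [wordVal_eq_lift, wordVal_eq_lift, h7, h7, h6]
  · rintro ⟨A, _, n, h⟩
    exact inJoin_of_mDivides
      (fun u v hu hv => eqvCon_of_wEquiv (wEquiv_XY_iff.2 ⟨hu, hv⟩)) h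

theorem rLevel_and_op_iff_mDivides [Finite M] {k : ℕ} : (RLevel (k + 1) M ∧ RLevel (k + 1) Mᵐᵒᵖ) ↔
    ∃ (A : Type) (_ : Fintype A) (n : ℕ), MDivides M (eqvCon A ZKind.WI (k + 1) n).Quotient := by
  constructor
  · rintro ⟨h, h'⟩
    obtain ⟨n, hn⟩ := exists_listW_bound_of_rLevel h h' id
    refine ⟨M, Fintype.ofFinite M, n, mDivides_of_con_le _ (lift_id_surjective M) fun u v huv => ?_⟩
    rw [wordVal_eq_lift, wordVal_eq_lift]
    exact hn _ _ (wEquiv_WI_iff.1 huv)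
  · rintro ⟨A, _, n, h⟩
    refine ⟨rLevel_of_mDivides (n := 2 * n) (fun u v huv => ?_) h,
      rLevel_op_of_mDivides (n := 2 * n) (fun u v huv => ?_) h⟩
    · exact eqvCon_of_wEquiv (wEquiv_WI_iff.2 huv.listW)
    · exact eqvCon_of_wEquiv (wEquiv_WI_iff.2 (by simpa using huv.listW.reverse))

end Division

/-- Theorem: combinatorial characterization of the Trotter–Weil hierarchy via division. -/
theorem TW_characterization (M : Type) [Monoid M] [Finite M] (m : ℕ) (hm : 1 ≤ m) :
    (InRm m M ↔
      ∃ (A : Type) (_ : Fintype A) (n : ℕ), MDivides M (eqvCon A ZKind.X m n).Quotient) ∧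
    (InLm m M ↔
      ∃ (A : Type) (_ : Fintype A) (n : ℕ), MDivides M (eqvCon A ZKind.Y m n).Quotient) ∧
    (InJoin m M ↔
      ∃ (A : Type) (_ : Fintype A) (n : ℕ), MDivides M (eqvCon A ZKind.XY m n).Quotient) ∧
    ((InRm (m + 1) M ∧ InLm (m + 1) M) ↔
      ∃ (A : Type) (_ : Fintype A) (n : ℕ), MDivides M (eqvCon A ZKind.WI m n).Quotient) := by
  obtain ⟨k, rfl⟩ := Nat.exists_eq_add_of_le' hm
  exact ⟨inRLAux_iff.1.trans rLevel_iff_mDivides, inRLAux_iff.2.trans rLevel_op_iff_mDivides,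
    inJoin_iff_mDivides, (and_congr inRLAux_iff.1 inRLAux_iff.2).trans rLevel_and_op_iff_mDivides⟩
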